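/- arXiv:2601.22122 — 2 statements merged into one kernel-verified Lean document; each statement's English description precedes it below -/
import Mathlib

section
/- Let M be a differential space. The following are equivalent: (1) there exist n ∈ ℕ and a closed smooth embedding M → ℝ^n, where ℝ^n carries the differential structure of all infinitely ℝ-differentiable functions ℝ^n → ℂ; (2) there exist finitely many f₁,…,f_n ∈ C^∞(M) such that for every f ∈ C^∞(M) there is an infinitely ℝ-differentiable F : ℂ^n → ℂ with f = F∘(f₁,…,f_n); (3) there exists n ∈ ℕ such that for every x ∈ M one can find an open neighborhood U ⊆ M of x and f₁,…,f_n ∈ C^∞(U) such that for every f ∈ C^∞(M) there is an infinitely ℝ-differentiable F : ℂ^n → ℂ with f = F∘(f₁,…,f_n) on U. -/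
open scoped Topology

/-- A differential structure (in the sense of Sikorski and Aronszajn) on a topological space `M`:
a nonempty set of continuous complex-valued functions which separates points, is closed under
composition with infinitely `ℝ`-differentiable functions `ℂⁿ → ℂ`, and is local. -/
structure IsDiffStructure (M : Type*) [TopologicalSpace M] (D : Set (M → ℂ)) : Prop where
  nonempty : D.Nonempty
  continuous : ∀ f ∈ D, Continuous f
  separates : ∀ x y : M, x ≠ y → ∃ f ∈ D, f x ≠ f y
  comp : ∀ (n : ℕ) (g : Fin n → (M → ℂ)), (∀ i, g i ∈ D) →
    ∀ F : (Fin n → ℂ) → ℂ, ContDiff ℝ (⊤ : ℕ∞) F → (fun x => F fun i => g i x) ∈ D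
  locality : ∀ f : M → ℂ,
    (∀ x : M, ∃ U ∈ 𝓝 x, ∃ g ∈ D, ∀ y ∈ U, f y = g y) → f ∈ D

/-- The differential structure induced on a subset `A ⊆ M`: functions that locally (on `A`)
agree with elements of `D`. -/
def restrictD {M : Type*} [TopologicalSpace M] (D : Set (M → ℂ)) (A : Set M) :
    Set (A → ℂ) :=
  {f | ∀ x : A, ∃ U : Set M, IsOpen U ∧ (x : M) ∈ U ∧
    ∃ g ∈ D, ∀ y : A, (y : M) ∈ U → f y = g y}

/-- The differential structure on `ℝⁿ`: all infinitely `ℝ`-differentiable functions to `ℂ`. -/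
def euclD (n : ℕ) : Set ((Fin n → ℝ) → ℂ) := {f | ContDiff ℝ (⊤ : ℕ∞) f}

/-- A closed smooth embedding between (topological spaces carrying) differential structures:
a closed topological embedding which is a diffeomorphism onto its image (with the restricted
differential structure). -/
def IsClosedSmoothEmbedding {M M' : Type*} [TopologicalSpace M] [TopologicalSpace M']
    (D : Set (M → ℂ)) (D' : Set (M' → ℂ)) (f : M → M') : Prop :=
  Topology.IsClosedEmbedding f ∧
  (∀ h ∈ restrictD D' (Set.range f), (fun x => h ⟨f x, Set.mem_range_self x⟩) ∈ D) ∧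
  (∀ g ∈ D, ∃ h ∈ restrictD D' (Set.range f), ∀ x, h ⟨f x, Set.mem_range_self x⟩ = g x)

namespace IsDiffStructure

variable {M : Type*} [TopologicalSpace M] {D : Set (M → ℂ)}

theorem mem_of_eventuallyEq (hD : IsDiffStructure M D) {f : M → ℂ}
    (h : ∀ x, ∃ g ∈ D, f =ᶠ[𝓝 x] g) : f ∈ D := by
  refine hD.locality f fun x => ?_
  obtain ⟨g, hg, hfg⟩ := h x
  exact ⟨_, hfg, g, hg, fun y hy => hy⟩

theorem comp_fintype (hD : IsDiffStructure M D) {α : Type*} [Fintype α] {g : α → M → ℂ}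
    (hg : ∀ a, g a ∈ D) {F : (α → ℂ) → ℂ} (hF : ContDiff ℝ (⊤ : ℕ∞) F) :
    (fun x => F fun a => g a x) ∈ D := by
  let e := Fintype.equivFin α
  have h := hD.comp _ (fun i => g (e.symm i)) (fun i => hg _) (fun v => F fun a => v (e a))
    (hF.comp (contDiff_pi.2 fun a => contDiff_apply ℝ ℂ (e a)))
  simpa using h

theorem map (hD : IsDiffStructure M D) {f : M → ℂ} (hf : f ∈ D) {F : ℂ → ℂ}
    (hF : ContDiff ℝ (⊤ : ℕ∞) F) : (fun x => F (f x)) ∈ D :=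
  hD.comp_fintype (α := Unit) (g := fun _ => f) (fun _ => hf) (F := fun v => F (v ()))
    (hF.comp (contDiff_apply ℝ ℂ ()))

theorem map₂ (hD : IsDiffStructure M D) {f g : M → ℂ} (hf : f ∈ D) (hg : g ∈ D) {F : ℂ × ℂ → ℂ}
    (hF : ContDiff ℝ (⊤ : ℕ∞) F) : (fun x => F (f x, g x)) ∈ D :=
  hD.comp_fintype (α := Bool) (g := fun b => cond b f g) (by rintro (_ | _) <;> assumption)
    (F := fun v => F (v true, v false))
    (hF.comp ((contDiff_apply ℝ ℂ true).prodMk (contDiff_apply ℝ ℂ false)))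

theorem const (hD : IsDiffStructure M D) (c : ℂ) : (fun _ => c) ∈ D := by
  obtain ⟨f, hf⟩ := hD.nonempty
  exact hD.map hf (F := fun _ => c) contDiff_const

theorem add (hD : IsDiffStructure M D) {f g : M → ℂ} (hf : f ∈ D) (hg : g ∈ D) :
    (fun x => f x + g x) ∈ D :=
  hD.map₂ hf hg (F := fun p => p.1 + p.2) (contDiff_fst.add contDiff_snd)

theorem mul (hD : IsDiffStructure M D) {f g : M → ℂ} (hf : f ∈ D) (hg : g ∈ D) :
    (fun x => f x * g x) ∈ D :=
  hD.map₂ hf hg (F := fun p => p.1 * p.2) (contDiff_fst.mul contDiff_snd)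

theorem sum (hD : IsDiffStructure M D) {ι : Type*} (s : Finset ι) {f : ι → M → ℂ}
    (hf : ∀ i, f i ∈ D) : (fun x => ∑ i ∈ s, f i x) ∈ D := by
  classical
  induction s using Finset.induction_on with
  | empty => simpa using hD.const 0
  | insert a s ha ih => simpa [Finset.sum_insert ha] using hD.add (hf a) ih

theorem finsum (hD : IsDiffStructure M D) {ι : Type*} {f : ι → M → ℂ} (hf : ∀ i, f i ∈ D)
    (hfin : LocallyFinite fun i => Function.support (f i)) : (fun x => ∑ᶠ i, f i x) ∈ D := by
  refine hD.mem_of_eventuallyEq fun x => ?_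
  obtain ⟨s, hs⟩ := finsum_eventually_eq_sum hfin x
  exact ⟨_, hD.sum s hf, hs⟩

theorem map_real (hD : IsDiffStructure M D) {h : M → ℝ} (hh : (fun x => (h x : ℂ)) ∈ D)
    {χ : ℝ → ℝ} (hχ : ContDiff ℝ (⊤ : ℕ∞) χ) : (fun x => (χ (h x) : ℂ)) ∈ D := by
  have := hD.map hh (F := fun z => (χ z.re : ℂ))
    (Complex.ofRealCLM.contDiff.comp (hχ.comp Complex.reCLM.contDiff))
  simpa using this

theorem exists_separating_function (hD : IsDiffStructure M D) {x : M} {T : Set M}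
    (hT : IsCompact T) (hx : x ∉ T) :
    ∃ h : M → ℝ, (fun y => (h y : ℂ)) ∈ D ∧ (∀ y, 0 ≤ h y) ∧ h x = 0 ∧ ∀ y ∈ T, 1 ≤ h y := by
  refine hT.induction_on (p := fun T => ∃ h : M → ℝ, (fun y => (h y : ℂ)) ∈ D ∧ (∀ y, 0 ≤ h y) ∧
    h x = 0 ∧ ∀ y ∈ T, 1 ≤ h y) ⟨fun _ => 0, by simpa using hD.const 0, by simp, rfl, by simp⟩
    ?_ ?_ ?_
  · rintro s t hst ⟨h, hh, h0, hx, h1⟩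
    exact ⟨h, hh, h0, hx, fun y hy => h1 y (hst hy)⟩
  · rintro s t ⟨h, hh, h0, hx, h1⟩ ⟨k, hk, k0, kx, k1⟩
    refine ⟨fun y => h y + k y, by simpa using hD.add hh hk, fun y => add_nonneg (h0 y) (k0 y),
      by simp [hx, kx], ?_⟩
    rintro y (hy | hy)
    · linarith [h1 y hy, k0 y]
    · linarith [k1 y hy, h0 y]
  · intro y hy
    obtain ⟨f, hf, hfxy⟩ := hD.separates x y (fun h => hx (h ▸ hy))
    have hpos : 0 < ‖f y - f x‖ := norm_pos_iff.2 (sub_ne_zero.2 hfxy.symm)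
    set c : ℝ := 2 / ‖f y - f x‖ ^ 2 with hc
    have hcont : Continuous fun z => c * ‖f z - f x‖ ^ 2 := by
      have := hD.continuous f hf
      fun_prop
    refine ⟨{z | 1 ≤ c * ‖f z - f x‖ ^ 2}, ?_, fun z => c * ‖f z - f x‖ ^ 2, ?_, ?_, by simp, ?_⟩
    · have : ∀ᶠ z in 𝓝 y, 1 < c * ‖f z - f x‖ ^ 2 := by
        refine hcont.continuousAt.eventually (lt_mem_nhds ?_)
        have : c * ‖f y - f x‖ ^ 2 = 2 := div_mul_cancel₀ _ (by positivity)
        simp [this]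
      exact nhdsWithin_le_nhds (this.mono fun z hz => le_of_lt hz)
    · refine hD.map hf (F := fun w => ((c * ‖w - f x‖ ^ 2 : ℝ) : ℂ)) ?_
      exact Complex.ofRealCLM.contDiff.comp
        (contDiff_const.mul ((contDiff_id.sub contDiff_const).norm_sq ℝ))
    · intro z
      positivity
    · exact fun z hz => hz

variable [T2Space M] [LocallyCompactSpace M]

theorem exists_bump_at (hD : IsDiffStructure M D) {x : M} {U : Set M} (hU : U ∈ 𝓝 x) :
    ∃ b : M → ℝ, (fun y => (b y : ℂ)) ∈ D ∧ (∀ y, b y ∈ Set.Icc 0 1) ∧ (∀ᶠ y in 𝓝 x, b y = 1) ∧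
      tsupport b ⊆ U := by
  classical
  obtain ⟨K, hK, hKU, hKc⟩ := local_compact_nhds hU
  have hfr : IsCompact (frontier K) :=
    hKc.of_isClosed_subset isClosed_frontier hKc.isClosed.frontier_subset
  obtain ⟨h, hh, h0, hx, h1⟩ := hD.exists_separating_function (x := x) hfr
    fun hx => hx.2 (mem_interior_iff_mem_nhds.2 hK)
  have hcont : Continuous h := Complex.continuous_re.comp (hD.continuous _ hh)
  let χ : ℝ → ℝ := fun t => Real.smoothTransition (2 - 3 * t)
  have hχ : ContDiff ℝ (⊤ : ℕ∞) χ :=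
    Real.smoothTransition.contDiff.comp (contDiff_const.sub (contDiff_const.mul contDiff_id))
  refine ⟨fun y => if y ∈ K then χ (h y) else 0, ?_, ?_, ?_, ?_⟩
  · refine hD.mem_of_eventuallyEq fun y => ?_
    by_cases hy : y ∈ K
    · by_cases hy' : y ∈ interior K
      · refine ⟨_, hD.map_real hh hχ, ?_⟩
        filter_upwards [mem_interior_iff_mem_nhds.1 hy'] with z hz
        simp [hz]
      · refine ⟨_, hD.const 0, ?_⟩
        have hy1 : (2 / 3 : ℝ) < h y := by
          linarith [h1 y ⟨subset_closure hy, hy'⟩]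
        filter_upwards [hcont.continuousAt.eventually (lt_mem_nhds hy1)] with z hz
        have : χ (h z) = 0 := Real.smoothTransition.zero_of_nonpos (by linarith)
        simp [this]
    · refine ⟨_, hD.const 0, ?_⟩
      filter_upwards [hKc.isClosed.isOpen_compl.mem_nhds hy] with z hz
      simp [show z ∉ K from hz]
  · intro y
    dsimp only
    split_ifs
    · exact ⟨Real.smoothTransition.nonneg _, Real.smoothTransition.le_one _⟩
    · simp
  · have hx1 : h x < 1 / 3 := by rw [hx]; norm_num
    filter_upwards [hK, hcont.continuousAt.eventually (gt_mem_nhds hx1)] with z hz hz'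
    rw [if_pos hz]
    exact Real.smoothTransition.eq_one_iff_one_le.2 (by linarith)
  · refine (closure_minimal ?_ hKc.isClosed).trans hKU
    intro y hy
    by_contra hyK
    exact hy (if_neg hyK)

theorem exists_bump (hD : IsDiffStructure M D) {K U : Set M} (hK : IsCompact K)
    (hU : IsOpen U) (hKU : K ⊆ U) :
    ∃ b : M → ℝ, (fun y => (b y : ℂ)) ∈ D ∧ (∀ y, b y ∈ Set.Icc 0 1) ∧
      (∀ x ∈ K, ∀ᶠ y in 𝓝 x, b y = 1) ∧ tsupport b ⊆ U := by
  refine hK.induction_on (p := fun K => ∃ b : M → ℝ, (fun y => (b y : ℂ)) ∈ D ∧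
      (∀ y, b y ∈ Set.Icc 0 1) ∧ (∀ x ∈ K, ∀ᶠ y in 𝓝 x, b y = 1) ∧ tsupport b ⊆ U) ?_ ?_ ?_ ?_
  · exact ⟨fun _ => 0, by simpa using hD.const 0, by simp, by simp, by simp [tsupport]⟩
  · rintro s t hst ⟨b, hb, hb01, hb1, hbU⟩
    exact ⟨b, hb, hb01, fun x hx => hb1 x (hst hx), hbU⟩
  · rintro s t ⟨b, hb, hb01, hb1, hbU⟩ ⟨c, hc, hc01, hc1, hcU⟩
    refine ⟨fun y => 1 - (1 - b y) * (1 - c y), ?_, ?_, ?_, ?_⟩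
    · have := hD.map₂ hb hc (F := fun p => 1 - (1 - p.1) * (1 - p.2)) (by fun_prop)
      simpa using this
    · intro y
      obtain ⟨hb0, hb1⟩ := hb01 y
      obtain ⟨hc0, hc1⟩ := hc01 y
      constructor <;> nlinarith [mul_nonneg (sub_nonneg.2 hb1) (sub_nonneg.2 hc1)]
    · rintro x (hx | hx)
      · filter_upwards [hb1 x hx] with y hy
        simp [hy]
      · filter_upwards [hc1 x hx] with y hy
        simp [hy]
    · refine (closure_minimal ?_ ((isClosed_tsupport b).union (isClosed_tsupport c))).trans
        (Set.union_subset hbU hcU)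
      intro y hy
      by_contra hyn
      rw [Set.mem_union, not_or] at hyn
      exact hy (by simp [image_eq_zero_of_notMem_tsupport hyn.1,
        image_eq_zero_of_notMem_tsupport hyn.2])
  · intro x hx
    obtain ⟨b, hb, hb01, hb1, hbU⟩ := hD.exists_bump_at (hU.mem_nhds (hKU hx))
    refine ⟨_, nhdsWithin_le_nhds (eventually_eventually_nhds.2 hb1), b, hb, hb01,
      fun y hy => hy, hbU⟩

theorem exists_isProperMap [SecondCountableTopology M] (hD : IsDiffStructure M D) :
    ∃ p ∈ D, IsProperMap p := by
  let K := CompactExhaustion.choice M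
  choose b hb hb01 hb1 hbK using fun n =>
    hD.exists_bump (K.isCompact n) isOpen_interior (K.subset_interior_succ n)
  have hfin : LocallyFinite fun n => Function.support fun x => (1 - b n x : ℂ) := by
    intro x
    obtain ⟨m, hm⟩ := K.exists_mem_nhds x
    refine ⟨K m, hm, (Set.finite_lt_nat m).subset ?_⟩
    rintro n ⟨y, hy, hym⟩
    by_contra hn
    have := (hb1 n y (K.subset (not_lt.1 hn) hym)).self_of_nhds
    simp [this] at hy
  have hpD := hD.finsum (f := fun n x => (1 - b n x : ℂ))
    (fun n => by simpa using hD.map (hb n) (F := fun z => 1 - z) (by fun_prop)) hfin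
  refine ⟨_, hpD, isProperMap_iff_tendsto_cocompact.2 ⟨hD.continuous _ hpD, ?_⟩⟩
  rw [← Metric.cobounded_eq_cocompact, ← tendsto_norm_atTop_iff_cobounded, Filter.tendsto_atTop]
  intro C
  obtain ⟨m, hm⟩ := exists_nat_ge C
  filter_upwards [(K.isCompact m).compl_mem_cocompact] with x hx
  have hsupp : (Function.support fun n => (1 - b n x : ℂ)).Finite := hfin.point_finite x
  have hsub : (Function.support fun n => (1 - b n x : ℂ)) ⊆
      ((hsupp.toFinset ∪ Finset.range m : Finset ℕ) : Set ℕ) := by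
    intro n hn
    simpa using Or.inl hn
  rw [finsum_eq_sum_of_support_subset _ hsub]
  have hre : ∑ n ∈ hsupp.toFinset ∪ Finset.range m, (1 - b n x : ℂ) =
      ((∑ n ∈ hsupp.toFinset ∪ Finset.range m, (1 - b n x) : ℝ) : ℂ) := by
    push_cast
    rfl
  have hle : ∑ n ∈ Finset.range m, (1 - b n x) ≤
      ∑ n ∈ hsupp.toFinset ∪ Finset.range m, (1 - b n x) :=
    Finset.sum_le_sum_of_subset_of_nonneg Finset.subset_union_right
      fun n _ _ => sub_nonneg.2 (hb01 n x).2
  have hone : ∀ n ∈ Finset.range m, 1 - b n x = 1 := by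
    intro n hn
    have hxn : x ∉ tsupport (b n) := fun h =>
      hx (K.subset (Finset.mem_range.1 hn) (interior_subset (hbK n h)))
    simp [image_eq_zero_of_notMem_tsupport hxn]
  rw [Finset.sum_congr rfl hone] at hle
  rw [hre, Complex.norm_real]
  refine le_trans ?_ (le_abs_self _)
  rw [Finset.sum_const, Finset.card_range, nsmul_one] at hle
  linarith

end IsDiffStructure

open scoped Manifold in
theorem Topology.IsClosedEmbedding.exists_contDiff_extension {M E : Type*} [TopologicalSpace M]
    [NormedAddCommGroup E] [NormedSpace ℝ E] [FiniteDimensional ℝ E] {H : M → E}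
    (hH : Topology.IsClosedEmbedding H) {g : M → ℂ}
    (hg : ∀ x, ∃ F : E → ℂ, ContDiff ℝ (⊤ : ℕ∞) F ∧ ∀ᶠ y in 𝓝 x, g y = F (H y)) :
    ∃ F : E → ℂ, ContDiff ℝ (⊤ : ℕ∞) F ∧ ∀ y, g y = F (H y) := by
  have hconv : ∀ z, Convex ℝ {w | ∀ x, H x = z → w = g x} := by
    intro z u hu v hv a b _ _ hab x hx
    rw [hu x hx, hv x hx, ← add_smul, hab, one_smul]
  obtain ⟨F, hF⟩ := exists_contMDiffMap_forall_mem_convex_of_local (n := (⊤ : ℕ∞))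
    𝓘(ℝ, E) hconv fun z => by
      by_cases hz : z ∈ Set.range H
      · obtain ⟨x, rfl⟩ := hz
        obtain ⟨F, hF, hxF⟩ := hg x
        rw [hH.isInducing.nhds_eq_comap, Filter.eventually_comap] at hxF
        exact ⟨_, hxF, F, hF.contMDiff.contMDiffOn, fun w hw y hy => by rw [hw y hy, hy]⟩
      · exact ⟨_, hH.isClosed_range.isOpen_compl.mem_nhds hz, fun _ => 0, contMDiffOn_const,
          fun w hw y hy => absurd ⟨y, hy⟩ hw⟩
  exact ⟨F, F.contMDiff.contDiff, fun y => (hF (H y) y rfl).symm⟩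

namespace IsDiffStructure

variable {M : Type*} [TopologicalSpace M] {D : Set (M → ℂ)}

theorem isClosedEmbedding_of_comp_isProperMap (hD : IsDiffStructure M D) {α : Type*} [Fintype α]
    {f : α → M → ℂ} (hf : ∀ a, f a ∈ D) (hinj : ∀ x y, (∀ a, f a x = f a y) → x = y)
    {F : (α → ℂ) → ℂ} (hF : Continuous F) (hp : IsProperMap fun x => F fun a => f a x) :
    Topology.IsClosedEmbedding fun x a => f a x := by
  have hcont : Continuous fun x a => f a x := continuous_pi fun a => hD.continuous _ (hf a)
  exact .of_continuous_injective_isClosedMap hcont (fun x y hxy => hinj x y (congrFun hxy))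
    (isProperMap_of_comp_of_t2 hcont hF hp).isClosedMap

theorem exists_isClosedSmoothEmbedding_of_generators [T2Space M] [LocallyCompactSpace M]
    [SecondCountableTopology M] (hD : IsDiffStructure M D) {n : ℕ} {f : Fin n → M → ℂ}
    (hf : ∀ i, f i ∈ D)
    (hgen : ∀ g ∈ D, ∃ F : (Fin n → ℂ) → ℂ, ContDiff ℝ (⊤ : ℕ∞) F ∧
      g = fun x => F fun i => f i x) :
    ∃ (m : ℕ) (φ : M → (Fin m → ℝ)), IsClosedSmoothEmbedding D (euclD m) φ := by
  obtain ⟨p, hpD, hp⟩ := hD.exists_isProperMap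
  obtain ⟨P, hP, rfl⟩ := hgen p hpD
  have hinj : ∀ x y, (∀ i, f i x = f i y) → x = y := by
    intro x y hxy
    by_contra hne
    obtain ⟨g, hg, hgxy⟩ := hD.separates x y hne
    obtain ⟨F, -, rfl⟩ := hgen g hg
    exact hgxy (congrArg F (funext hxy))
  have hH := hD.isClosedEmbedding_of_comp_isProperMap hf hinj hP.continuous hp
  let L : (Fin n → ℂ) ≃L[ℝ] (Fin (Module.finrank ℝ (Fin n → ℂ)) → ℝ) :=
    ContinuousLinearEquiv.ofFinrankEq (by simp)
  refine ⟨_, fun x => L fun i => f i x, L.toHomeomorph.isClosedEmbedding.comp hH, ?_, ?_⟩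
  · intro h hh
    refine hD.mem_of_eventuallyEq fun x => ?_
    obtain ⟨U, hU, hxU, G, hG, hGh⟩ := hh ⟨_, Set.mem_range_self x⟩
    refine ⟨_, hD.comp_fintype hf (ContDiff.comp hG L.contDiff), ?_⟩
    filter_upwards [(hU.preimage (L.continuous.comp hH.continuous)).mem_nhds hxU] with y hy
    exact hGh ⟨_, Set.mem_range_self y⟩ hy
  · intro g hg
    obtain ⟨F, hF, rfl⟩ := hgen g hg
    refine ⟨fun z => F (L.symm z), fun z => ⟨Set.univ, isOpen_univ, trivial, fun z => F (L.symm z),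
      hF.comp L.symm.contDiff, fun _ _ => rfl⟩, fun x => by simp⟩

theorem exists_generators_of_isClosedSmoothEmbedding {n : ℕ} {φ : M → (Fin n → ℝ)}
    (hφ : IsClosedSmoothEmbedding D (euclD n) φ) :
    ∃ f : Fin n → M → ℂ, (∀ i, f i ∈ D) ∧ ∀ g ∈ D, ∃ F : (Fin n → ℂ) → ℂ,
      ContDiff ℝ (⊤ : ℕ∞) F ∧ g = fun x => F fun i => f i x := by
  obtain ⟨hemb, hsmooth, hsurj⟩ := hφ
  refine ⟨fun i x => (φ x i : ℂ), fun i => ?_, fun g hg => ?_⟩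
  · have hi : (fun z : Fin n → ℝ => (z i : ℂ)) ∈ euclD n := by
      change ContDiff ℝ (⊤ : ℕ∞) _
      exact Complex.ofRealCLM.contDiff.comp (contDiff_apply ℝ ℝ i)
    exact hsmooth (fun z => ((z : Fin n → ℝ) i : ℂ)) fun z => ⟨Set.univ, isOpen_univ, trivial,
      _, hi, fun _ _ => rfl⟩
  · obtain ⟨h, hh, hhg⟩ := hsurj g hg
    obtain ⟨F, hF, hgF⟩ := hemb.exists_contDiff_extension (g := g) fun x => by
      obtain ⟨U, hU, hxU, G, hG, hGh⟩ := hh ⟨_, Set.mem_range_self x⟩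
      refine ⟨G, hG, ?_⟩
      filter_upwards [(hU.preimage hemb.continuous).mem_nhds hxU] with y hy
      rw [← hhg]
      exact hGh ⟨_, Set.mem_range_self y⟩ hy
    refine ⟨fun v => F fun i => (v i).re, hF.comp (contDiff_pi.2 fun i =>
      Complex.reCLM.contDiff.comp (contDiff_apply ℝ ℂ i)), funext fun x => ?_⟩
    simpa using hgF x

end IsDiffStructure

section Coloring

variable {M : Type*} [TopologicalSpace M] [T2Space M]

theorem exists_isOpen_superset_disjoint {ι : Type*} [Finite ι] {C O : ι → Set M}
    (hC : ∀ i, IsCompact (C i)) (hO : ∀ i, IsOpen (O i)) (hCO : ∀ i, C i ⊆ O i) :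
    ∃ W : ι → Set M, (∀ i, IsOpen (W i)) ∧ (∀ i, C i ⊆ W i) ∧ (∀ i, W i ⊆ O i) ∧
      ∀ i j, Disjoint (C i) (C j) → Disjoint (W i) (W j) := by
  have : ∀ i j, ∃ U V : Set M, IsOpen U ∧ IsOpen V ∧ C i ⊆ U ∧ C j ⊆ V ∧
      (Disjoint (C i) (C j) → Disjoint U V) := by
    intro i j
    by_cases h : Disjoint (C i) (C j)
    · obtain ⟨U, V, hU, hV, hiU, hjV, hUV⟩ := SeparatedNhds.of_isCompact_isCompact (hC i) (hC j) h
      exact ⟨U, V, hU, hV, hiU, hjV, fun _ => hUV⟩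
    · exact ⟨Set.univ, Set.univ, isOpen_univ, isOpen_univ, Set.subset_univ _, Set.subset_univ _,
        fun h' => absurd h' h⟩
  choose U V hU hV hCU hCV hUV using this
  refine ⟨fun i => O i ∩ ⋂ j, (U i j ∩ V j i), fun i => (hO i).inter
    (isOpen_iInter_of_finite fun j => (hU i j).inter (hV j i)), fun i => Set.subset_inter (hCO i)
    (Set.subset_iInter fun j => Set.subset_inter (hCU i j) (hCV j i)),
    fun i => Set.inter_subset_left, fun i j hij => ?_⟩
  refine (hUV i j hij).mono ?_ ?_
  · exact fun x hx => (Set.mem_iInter.1 hx.2 j).1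
  · exact fun x hx => (Set.mem_iInter.1 hx.2 i).2

/-- For every assignment of neighborhoods to the points of `L`, the set `s` has a finite cover by
compact sets, each contained in one of these neighborhoods, which is colored by `κ` in such a way
that distinct sets of the same color are disjoint. -/
def HasColoredCovers (κ : Type) (L s : Set M) : Prop :=
  ∀ 𝒰 : M → Set M, (∀ x ∈ L, 𝒰 x ∈ 𝓝 x) →
    ∃ (ι : Type) (_ : Finite ι) (col : ι → κ) (C : ι → Set M),
      (∀ i, IsCompact (C i)) ∧ (∀ i, ∃ x ∈ L, C i ⊆ 𝒰 x) ∧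
      (∀ i j, i ≠ j → col i = col j → Disjoint (C i) (C j)) ∧ s ⊆ ⋃ i, C i

theorem HasColoredCovers.union {κ : Type} {L s t : Set M} (hs : HasColoredCovers κ L s)
    (ht : HasColoredCovers κ L t) : HasColoredCovers κ L (s ∪ t) := by
  classical
  intro 𝒰 h𝒰
  obtain ⟨ιt, _, colt, T, hTc, hT𝒰, hTd, htT⟩ :=
    ht (fun x => interior (𝒰 x)) fun x hx => interior_mem_nhds.2 (h𝒰 x hx)
  choose u huL hTu using hT𝒰
  obtain ⟨W, hW, hTW, hWu, hWd⟩ :=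
    exists_isOpen_superset_disjoint hTc (fun _ => isOpen_interior) hTu
  obtain ⟨ιs, _, cols, S, hSc, hSV, hSd, hsS⟩ :=
    hs (fun x => 𝒰 x ∩ ⋂ j, if x ∈ T j then W j else (T j)ᶜ) fun x hx => by
      refine Filter.inter_mem (h𝒰 x hx) (Filter.iInter_mem.2 fun j => ?_)
      split_ifs with hxj
      · exact (hW j).mem_nhds (hTW j hxj)
      · exact (hTc j).isClosed.isOpen_compl.mem_nhds hxj
  choose v hvL hSv using hSV
  have hSW : ∀ i j, ¬ Disjoint (S i) (T j) → S i ⊆ W j := by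
    intro i j hij
    have hsub : S i ⊆ if v i ∈ T j then W j else (T j)ᶜ := fun y hy =>
      Set.mem_iInter.1 (hSv i hy).2 j
    split_ifs at hsub with hvj
    · exact hsub
    · exact absurd (Set.disjoint_left.2 hsub) hij
  let R : ιt → Set ιs := fun j => {i | cols i = colt j ∧ ¬ Disjoint (S i) (T j)}
  let T' : ιt → Set M := fun j => T j ∪ ⋃ i ∈ R j, S i
  have hT'W : ∀ j, T' j ⊆ W j := fun j =>
    Set.union_subset (hTW j) (Set.iUnion₂_subset fun i hi => hSW i j hi.2)
  have hmixed : ∀ j i, (∀ j, colt j = cols i → Disjoint (S i) (T j)) → colt j = cols i →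
      Disjoint (T' j) (S i) := by
    intro j i hi hcol
    refine Set.disjoint_union_left.2 ⟨(hi j hcol).symm, Set.disjoint_iUnion₂_left.2 ?_⟩
    intro i' hi'
    refine hSd i' i ?_ (hi'.1.trans hcol)
    rintro rfl
    exact hi'.2 (hi j hcol)
  refine ⟨ιt ⊕ {i : ιs // ∀ j, colt j = cols i → Disjoint (S i) (T j)}, inferInstance,
    Sum.elim colt fun i => cols i, Sum.elim T' fun i => S i, ?_, ?_, ?_, ?_⟩
  · rintro (j | i)
    · exact (hTc j).union ((Set.toFinite _).isCompact_biUnion fun i _ => hSc i)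
    · exact hSc i
  · rintro (j | i)
    · exact ⟨u j, huL j, (hT'W j).trans ((hWu j).trans interior_subset)⟩
    · exact ⟨v i, hvL i, (hSv i).trans Set.inter_subset_left⟩
  · rintro (j | i) (j' | i') hne hcol
    · exact (hWd j j' (hTd j j' (fun h => hne (h ▸ rfl)) hcol)).mono (hT'W j) (hT'W j')
    · exact hmixed j i' i'.2 hcol
    · exact (hmixed j' i i.2 hcol.symm).symm
    · exact hSd i i' (fun h => hne (congrArg _ (Subtype.ext h))) hcol
  · rintro y (hy | hy)
    · obtain ⟨i, hi⟩ := Set.mem_iUnion.1 (hsS hy)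
      by_cases h : ∀ j, colt j = cols i → Disjoint (S i) (T j)
      · exact Set.mem_iUnion.2 ⟨.inr ⟨i, h⟩, hi⟩
      · push Not at h
        obtain ⟨j, hj, hij⟩ := h
        exact Set.mem_iUnion.2 ⟨.inl j, Or.inr (Set.mem_biUnion ⟨hj.symm, hij⟩ hi)⟩
    · obtain ⟨j, hj⟩ := Set.mem_iUnion.1 (htT hy)
      exact Set.mem_iUnion.2 ⟨.inl j, Or.inl hj⟩

theorem HasColoredCovers.of_injOn {β : Type} [Fintype β] {L K : Set M} (hK : IsCompact K)
    (hKL : K ⊆ L) {f : M → β → ℝ} (hf : ContinuousOn f K) (hinj : Set.InjOn f K) :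
    HasColoredCovers (β → ZMod 2) L K := by
  classical
  intro 𝒰 h𝒰
  obtain ⟨δ, hδ, hball⟩ := lebesgue_number_lemma_of_metric (hK.image_of_continuousOn hf)
    (c := fun x : K => (f '' (K \ interior (𝒰 x)))ᶜ)
    (fun x => ((hK.diff isOpen_interior).image_of_continuousOn
      (hf.mono Set.sdiff_subset)).isClosed.isOpen_compl) (by
      rintro _ ⟨x, hx, rfl⟩
      refine Set.mem_iUnion.2 ⟨⟨x, hx⟩, ?_⟩
      rintro ⟨y, hy, hyx⟩
      rw [hinj hy.1 hx hyx] at hy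
      exact hy.2 (mem_interior_iff_mem_nhds.2 (h𝒰 x (hKL hx))))
  obtain ⟨ε, hε, hεδ⟩ := exists_between hδ
  let Q : (β → ℤ) → Set (β → ℝ) := fun z => {w | ∀ b, ε * z b ≤ w b ∧ w b ≤ ε * (z b + 1)}
  have hQc : ∀ z, IsClosed (Q z) := fun z => by
    simp only [Q, Set.ofPred_forall, Set.ofPred_and]
    exact isClosed_iInter fun b => (isClosed_le continuous_const (continuous_apply b)).inter
      (isClosed_le (continuous_apply b) continuous_const)
  have hfin : {z | ∃ x ∈ K, f x ∈ Q z}.Finite := by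
    obtain ⟨R, hR⟩ := (hK.image_of_continuousOn hf).isBounded.exists_norm_le
    obtain ⟨N, hN⟩ := exists_nat_ge (R / ε)
    rw [div_le_iff₀ hε] at hN
    refine (Set.finite_Icc (fun _ => -(N + 1 : ℤ)) (fun _ => (N : ℤ))).subset ?_
    rintro z ⟨x, hx, hxz⟩
    have hb : ∀ b, -(N + 1 : ℤ) ≤ z b ∧ z b ≤ N := by
      intro b
      have h1 := abs_le.1 ((norm_le_pi_norm (f x) b).trans (hR _ ⟨x, hx, rfl⟩))
      obtain ⟨h2, h3⟩ := hxz b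
      constructor
      · have : -(N + 1 : ℝ) ≤ z b := le_of_mul_le_mul_left (by linarith) hε
        exact_mod_cast this
      · have : (z b : ℝ) ≤ N := le_of_mul_le_mul_left (by linarith) hε
        exact_mod_cast this
    exact ⟨fun b => (hb b).1, fun b => (hb b).2⟩
  refine ⟨{z | ∃ x ∈ K, f x ∈ Q z}, hfin.to_subtype, fun z b => (z.1 b : ZMod 2),
    fun z => K ∩ f ⁻¹' Q z, ?_, ?_, ?_, ?_⟩
  · exact fun z => hK.of_isClosed_subset (hf.preimage_isClosed_of_isClosed hK.isClosed (hQc z))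
      Set.inter_subset_left
  · rintro ⟨z, x, hx, hxz⟩
    obtain ⟨u, hu⟩ := hball _ ⟨x, hx, rfl⟩
    refine ⟨u, hKL u.2, fun y hy => ?_⟩
    by_contra hyu
    refine hu (show f y ∈ Metric.ball (f x) δ from ?_)
      ⟨y, ⟨hy.1, fun h => hyu (interior_subset h)⟩, rfl⟩
    refine lt_of_le_of_lt ((dist_pi_le_iff hε.le).2 fun b => ?_) hεδ
    obtain ⟨h1, h2⟩ := hxz b
    obtain ⟨h3, h4⟩ := hy.2 b
    rw [Real.dist_eq, abs_le]
    constructor <;> linarith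
  · rintro ⟨z, hz⟩ ⟨z', hz'⟩ hne hcol
    refine Set.disjoint_left.2 fun y hy hy' => hne (Subtype.ext (funext fun b => ?_))
    have hdvd := (ZMod.intCast_eq_intCast_iff_dvd_sub _ _ 2).1 (congrFun hcol b)
    obtain ⟨h1, h2⟩ := hy.2 b
    obtain ⟨h3, h4⟩ := hy'.2 b
    have h5 : (z b : ℝ) ≤ z' b + 1 := le_of_mul_le_mul_left (by linarith) hε
    have h6 : (z' b : ℝ) ≤ z b + 1 := le_of_mul_le_mul_left (by linarith) hε
    norm_cast at h5 h6
    simp only at hdvd ⊢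
    lia
  · intro y hy
    have hyQ : f y ∈ Q fun b => ⌊f y b / ε⌋ := by
      intro b
      have h1 := (le_div_iff₀ hε).1 (Int.floor_le (f y b / ε))
      have h2 := (div_lt_iff₀ hε).1 (Int.lt_floor_add_one (f y b / ε))
      constructor <;> linarith
    exact Set.mem_iUnion.2 ⟨⟨_, y, hy, hyQ⟩, hy, hyQ⟩

theorem hasColoredCovers_of_locally_injOn [LocallyCompactSpace M] {β : Type} [Fintype β]
    {L : Set M} (hL : IsCompact L)
    (h : ∀ x ∈ L, ∃ V ∈ 𝓝 x, ∃ f : M → β → ℝ, Continuous f ∧ Set.InjOn f V) :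
    HasColoredCovers (β → ZMod 2) L L := by
  refine hL.induction_on (p := HasColoredCovers (β → ZMod 2) L) ?_ ?_ ?_ ?_
  · exact fun 𝒰 _ => ⟨Empty, inferInstance, nofun, nofun, nofun, nofun, nofun, Set.empty_subset _⟩
  · intro s t hst ht 𝒰 h𝒰
    obtain ⟨ι, hι, col, C, hC, hC𝒰, hCd, htC⟩ := ht 𝒰 h𝒰
    exact ⟨ι, hι, col, C, hC, hC𝒰, hCd, hst.trans htC⟩
  · exact fun s t => HasColoredCovers.union
  · intro x hx
    obtain ⟨V, hV, f, hf, hinj⟩ := h x hx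
    obtain ⟨K, hK, hKV, hKc⟩ := local_compact_nhds hV
    exact ⟨L ∩ K, Filter.inter_mem self_mem_nhdsWithin (nhdsWithin_le_nhds hK),
      .of_injOn (hL.inter hKc) Set.inter_subset_left hf.continuousOn
        (hinj.mono (Set.inter_subset_right.trans hKV))⟩

end Coloring

namespace IsDiffStructure

variable {M : Type*} [TopologicalSpace M] {D : Set (M → ℂ)}

theorem injOn_of_generators (hD : IsDiffStructure M D) {α : Type*} {f : α → M → ℂ} {V : Set M}
    (hgen : ∀ g ∈ D, ∃ F : (α → ℂ) → ℂ, ∀ y ∈ V, g y = F fun a => f a y) :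
    Set.InjOn (fun y a => f a y) V := by
  intro x hx y hy hxy
  by_contra hne
  obtain ⟨g, hg, hgxy⟩ := hD.separates x y hne
  obtain ⟨F, hF⟩ := hgen g hg
  exact hgxy (by rw [hF x hx, hF y hy]; exact congrArg F hxy)

variable [T2Space M] [LocallyCompactSpace M]

theorem exists_global_of_restrictD (hD : IsDiffStructure M D) {U : Set M} (hU : IsOpen U) {x : M}
    (hx : x ∈ U) {α : Type*} {f : α → U → ℂ} (hf : ∀ a, f a ∈ restrictD D U) :
    ∃ f' : α → M → ℂ, (∀ a, f' a ∈ D) ∧ ∀ᶠ y in 𝓝 x, ∃ h : y ∈ U, ∀ a, f' a y = f a ⟨y, h⟩ := by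
  classical
  obtain ⟨b, hb, -, hb1, hbU⟩ := hD.exists_bump_at (hU.mem_nhds hx)
  refine ⟨fun a y => if h : y ∈ U then b y * f a ⟨y, h⟩ else 0, fun a => ?_, ?_⟩
  · refine hD.mem_of_eventuallyEq fun y => ?_
    by_cases hy : y ∈ U
    · obtain ⟨V, hV, hyV, g, hg, hfg⟩ := hf a ⟨y, hy⟩
      refine ⟨_, hD.mul hb hg, ?_⟩
      filter_upwards [hV.mem_nhds hyV, hU.mem_nhds hy] with z hzV hzU
      simp only [dif_pos hzU]
      rw [hfg ⟨z, hzU⟩ hzV]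
    · refine ⟨_, hD.const 0, ?_⟩
      filter_upwards [(isClosed_tsupport b).isOpen_compl.mem_nhds fun h => hy (hbU h)] with z hz
      simp [image_eq_zero_of_notMem_tsupport hz]
  · filter_upwards [hb1, hU.mem_nhds hx] with z hz hzU
    exact ⟨hzU, fun a => by simp [hz, hzU]⟩

/-- Functions generating `D` on the members of a disjoint locally finite family of open sets can be
merged into finitely many functions which generate `D` near given compact subsets of these open
sets, and which distinguish the points of the compact subsets from all other points. -/
theorem exists_merged_generators (hD : IsDiffStructure M D) {ι : Type*} [Countable ι] {n : ℕ}
    {W C : ι → Set M} (hW : ∀ i, IsOpen (W i)) (hdisj : Pairwise fun i j => Disjoint (W i) (W j))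
    (hfin : LocallyFinite W) (hC : ∀ i, IsCompact (C i)) (hCW : ∀ i, C i ⊆ W i)
    {f : ι → Fin n → M → ℂ} (hf : ∀ i k, f i k ∈ D)
    (hgen : ∀ i, ∀ g ∈ D, ∃ F : (Fin n → ℂ) → ℂ, ContDiff ℝ (⊤ : ℕ∞) F ∧
      ∀ y ∈ W i, g y = F fun k => f i k y) :
    ∃ h : Fin n ⊕ Bool → M → ℂ, (∀ a, h a ∈ D) ∧ ∀ i, ∀ x ∈ C i,
      (∀ y, (∀ a, h a x = h a y) → x = y) ∧
      ∀ g ∈ D, ∃ F : (Fin n ⊕ Bool → ℂ) → ℂ, ContDiff ℝ (⊤ : ℕ∞) F ∧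
        ∀ᶠ y in 𝓝 x, g y = F fun a => h a y := by
  choose b hb _ hb1 hbW using fun i => hD.exists_bump (hC i) (hW i) (hCW i)
  obtain ⟨e, he⟩ := exists_injective_nat ι
  let v : ι → Fin n ⊕ Bool → M → ℂ := fun i =>
    Sum.elim (f i) fun t => cond t (fun _ => 1) (fun _ => (e i : ℂ))
  have hv : ∀ i a, v i a ∈ D := by
    rintro i (k | _ | _)
    exacts [hf i k, hD.const _, hD.const _]
  have hbW' : ∀ i y, b i y ≠ 0 → y ∈ W i := fun i y hy => hbW i (subset_tsupport _ hy)
  let h : Fin n ⊕ Bool → M → ℂ := fun a y => ∑ᶠ i, (b i y : ℂ) * v i a y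
  have hhv : ∀ i, ∀ y ∈ W i, ∀ a, h a y = b i y * v i a y := by
    intro i y hy a
    refine finsum_eq_single _ i fun j hj => ?_
    have : b j y = 0 := by
      by_contra hne
      exact Set.disjoint_left.1 (hdisj hj) (hbW' j y hne) hy
    simp [this]
  have hhv1 : ∀ i y, b i y = 1 → ∀ a, h a y = v i a y := by
    intro i y hy a
    rw [hhv i y (hbW' i y (by simp [hy])), hy, Complex.ofReal_one, one_mul]
  refine ⟨h, fun a => hD.finsum (fun i => hD.mul (hb i) (hv i a)) (hfin.subset fun i y hy => ?_),
    fun i x hx => ⟨fun y hxy => ?_, fun g hg => ?_⟩⟩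
  · refine hbW' i y fun h0 => hy ?_
    simp [h0]
  · have hxi : b i x = 1 := (hb1 i x hx).self_of_nhds
    have hy1 : h (.inr true) y = 1 := by
      rw [← hxy, hhv1 i x hxi]
      rfl
    obtain ⟨j, hj⟩ : ∃ j, (b j y : ℂ) * v j (.inr true) y ≠ 0 := by
      by_contra! hall
      have : h (.inr true) y = 0 := by
        simp only [h, hall, finsum_zero]
      simp [this] at hy1
    have hyj : b j y = 1 := by
      have := hhv j y (hbW' j y fun h0 => hj (by simp [h0])) (.inr true)
      rw [hy1] at this
      simpa [v, eq_comm] using this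
    have heq : ∀ a, v i a x = v j a y := fun a => by
      rw [← hhv1 i x hxi, ← hhv1 j y hyj, hxy]
    have hij : i = j := he (by simpa [v] using heq (.inr false))
    subst hij
    exact hD.injOn_of_generators (fun g hg => (hgen i g hg).imp fun _ hF => hF.2) (hCW i hx)
      (hbW' i y (by simp [hyj])) (funext fun k => heq (.inl k))
  · obtain ⟨F, hF, hgF⟩ := hgen i g hg
    refine ⟨fun w => F fun k => w (.inl k),
      hF.comp (contDiff_pi.2 fun k => contDiff_apply ℝ ℂ (Sum.inl k)), ?_⟩
    filter_upwards [hb1 i x hx] with y hy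
    rw [hgF y (hbW' i y (by simp [hy]))]
    exact congrArg F (funext fun k => (hhv1 i y hy (.inl k)).symm)

end IsDiffStructure

/-- Splitting the space into compact annuli and coloring covers of these yields a countable cover by
compact sets, subordinate to given neighborhoods, with finitely many colors such that sets of one
color have disjoint, locally finite neighborhoods. -/
theorem exists_finite_coloring_of_locally_injOn {M : Type*} [TopologicalSpace M] [T2Space M]
    [LocallyCompactSpace M] [SecondCountableTopology M] {β : Type} [Fintype β] {𝒰 : M → Set M}
    (h𝒰 : ∀ x, 𝒰 x ∈ 𝓝 x)
    (hinj : ∀ x : M, ∃ V ∈ 𝓝 x, ∃ f : M → β → ℝ, Continuous f ∧ Set.InjOn f V) :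
    ∃ (ι : Type) (_ : Countable ι) (col : ι → (β → ZMod 2) × Fin 3) (C W : ι → Set M),
      (∀ i, IsCompact (C i)) ∧ (∀ i, IsOpen (W i)) ∧ (∀ i, C i ⊆ W i) ∧ (∀ i, ∃ x, W i ⊆ 𝒰 x) ∧
      (∀ i j, i ≠ j → col i = col j → Disjoint (W i) (W j)) ∧ LocallyFinite W ∧
      ∀ x, ∃ i, x ∈ C i := by
  let K₀ := CompactExhaustion.choice M
  let K := K₀.shiftr
  have hK0 : K 0 = ∅ := rfl
  let L : ℕ → Set M := fun k => K (k + 1) \ interior (K k)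
  let N : ℕ → Set M := fun k => interior (K (k + 2)) \ K (k - 1)
  have hNo : ∀ k, IsOpen (N k) := fun k => isOpen_interior.sdiff (K.isCompact _).isClosed
  have hLN : ∀ k, L k ⊆ N k := by
    rintro k x ⟨hx, hx'⟩
    refine ⟨K.subset_interior_succ _ hx, fun hx1 => ?_⟩
    rcases k with _ | k
    · simp [hK0] at hx1
    · exact hx' (K.subset_interior_succ k hx1)
  have hNN : ∀ k l, k + 3 ≤ l → Disjoint (N k) (N l) := fun k l hkl =>
    Set.disjoint_left.2 fun x hx hx' =>
      hx'.2 (K.subset (show k + 2 ≤ l - 1 by lia) (interior_subset hx.1))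
  have hcover : ∀ k, ∃ (ι : Type) (_ : Finite ι) (col : ι → β → ZMod 2) (C W : ι → Set M),
      (∀ i, IsCompact (C i)) ∧ (∀ i, IsOpen (W i)) ∧ (∀ i, C i ⊆ W i) ∧ (∀ i, W i ⊆ N k) ∧
      (∀ i, ∃ x, W i ⊆ 𝒰 x) ∧
      (∀ i j, i ≠ j → col i = col j → Disjoint (W i) (W j)) ∧ L k ⊆ ⋃ i, C i := by
    intro k
    obtain ⟨ι, hι, col, C, hC, hCN, hCd, hLC⟩ := hasColoredCovers_of_locally_injOn
      ((K.isCompact (k + 1)).diff isOpen_interior) (fun x _ => hinj x)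
      (fun x => interior (𝒰 x) ∩ N k) fun x hx =>
        Filter.inter_mem (interior_mem_nhds.2 (h𝒰 x)) ((hNo k).mem_nhds (hLN k hx))
    choose u _ hu using hCN
    obtain ⟨W, hW, hCW, hWu, hWd⟩ :=
      exists_isOpen_superset_disjoint hC (fun i => isOpen_interior.inter (hNo k)) hu
    exact ⟨ι, hι, col, C, W, hC, hW, hCW, fun i => (hWu i).trans Set.inter_subset_right,
      fun i => ⟨u i, (hWu i).trans (Set.inter_subset_left.trans interior_subset)⟩,
      fun i j hij hcol => hWd i j (hCd i j hij hcol), hLC⟩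
  choose ι hι col C W hC hW hCW hWN hW𝒰 hWd hLC using hcover
  refine ⟨Σ k, ι k, inferInstance, fun i => (col i.1 i.2, Fin.ofNat 3 i.1), fun i => C i.1 i.2,
    fun i => W i.1 i.2, fun i => hC _ _, fun i => hW _ _, fun i => hCW _ _, fun i => hW𝒰 _ _,
    ?_, ?_, fun x => ?_⟩
  · rintro ⟨k, i⟩ ⟨l, j⟩ hne hcol
    obtain ⟨hcol, hmod⟩ := Prod.mk.inj hcol
    have hmod : k % 3 = l % 3 := congrArg Fin.val hmod
    rcases lt_trichotomy k l with hkl | rfl | hkl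
    · exact (hNN k l (by lia)).mono (hWN _ _) (hWN _ _)
    · exact hWd k i j (fun h => hne (h ▸ rfl)) hcol
    · exact ((hNN l k (by lia)).mono (hWN _ _) (hWN _ _)).symm
  · intro x
    obtain ⟨m, hm⟩ := K.exists_mem_nhds x
    refine ⟨K m, hm, ((Set.finite_le_nat m).biUnion fun k _ =>
      Set.finite_range fun i : ι k => (⟨k, i⟩ : Σ k, ι k)).subset ?_⟩
    rintro ⟨k, i⟩ ⟨y, hy, hym⟩
    refine Set.mem_biUnion (show k ≤ m from ?_) ⟨i, rfl⟩
    by_contra hk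
    exact (hWN k i hy).2 (K.subset (show m ≤ k - 1 by lia) hym)
  · obtain ⟨hx, hx'⟩ := K₀.mem_sdiff_shiftr_find x
    obtain ⟨i, hi⟩ := Set.mem_iUnion.1
      (hLC (K₀.find x) ⟨hx, fun h => hx' (interior_subset h)⟩)
    exact ⟨⟨_, i⟩, hi⟩

namespace IsDiffStructure

variable {M : Type*} [TopologicalSpace M] {D : Set (M → ℂ)}

theorem exists_generators_of_local [T2Space M] [LocallyCompactSpace M] [SecondCountableTopology M]
    (hD : IsDiffStructure M D) {n : ℕ}
    (hloc : ∀ x, ∃ V ∈ 𝓝 x, ∃ f : Fin n → M → ℂ, (∀ k, f k ∈ D) ∧ ∀ g ∈ D,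
      ∃ F : (Fin n → ℂ) → ℂ, ContDiff ℝ (⊤ : ℕ∞) F ∧ ∀ y ∈ V, g y = F fun k => f k y) :
    ∃ (m : ℕ) (f : Fin m → M → ℂ), (∀ i, f i ∈ D) ∧ ∀ g ∈ D, ∃ F : (Fin m → ℂ) → ℂ,
      ContDiff ℝ (⊤ : ℕ∞) F ∧ g = fun x => F fun i => f i x := by
  classical
  choose V hV f hf hgen using hloc
  obtain ⟨ι, _, col, C, W, hC, hW, hCW, hWV, hWd, hWfin, hcover⟩ :=
    exists_finite_coloring_of_locally_injOn (β := Fin n × Bool) hV fun x => by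
      refine ⟨V x, hV x, fun y a => cond a.2 (f x a.1 y).re (f x a.1 y).im, ?_, ?_⟩
      · refine continuous_pi ?_
        rintro ⟨k, _ | _⟩
        · exact Complex.continuous_im.comp (hD.continuous _ (hf x k))
        · exact Complex.continuous_re.comp (hD.continuous _ (hf x k))
      · intro y hy z hz hyz
        refine hD.injOn_of_generators (fun g hg => (hgen x g hg).imp fun _ hF => hF.2) hy hz
          (funext fun k => Complex.ext ?_ ?_)
        · exact congrFun hyz (k, true)
        · exact congrFun hyz (k, false)
  choose u hu using hWV
  choose h hh hsepgen using fun c => hD.exists_merged_generators (ι := {i // col i = c})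
    (W := fun i => W i) (C := fun i => C i) (f := fun i => f (u i)) (fun i => hW i)
    (fun i j hij => hWd i j (fun h => hij (Subtype.ext h)) (i.2.trans j.2.symm))
    (hWfin.comp_injective Subtype.val_injective) (fun i => hC i) (fun i => hCW i)
    (fun i => hf (u i)) fun i g hg => by
      obtain ⟨F, hF, hgF⟩ := hgen (u i) g hg
      exact ⟨F, hF, fun y hy => hgF y (hu i hy)⟩
  obtain ⟨p, hpD, hp⟩ := hD.exists_isProperMap
  let α := Option (((Fin n × Bool → ZMod 2) × Fin 3) × (Fin n ⊕ Bool))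
  let e := Fintype.equivFin α
  let q : α → M → ℂ := fun a => a.elim p fun a => h a.1 a.2
  have hq : ∀ a, q a ∈ D := by
    rintro (_ | ⟨c, a⟩)
    exacts [hpD, hh c a]
  have hclosed := hD.isClosedEmbedding_of_comp_isProperMap (f := fun i => q (e.symm i))
    (fun i => hq _) (fun x y hxy => by
      obtain ⟨i, hi⟩ := hcover x
      refine (hsepgen (col i) ⟨i, rfl⟩ x hi).1 y fun a => ?_
      simpa [q] using hxy (e (some (col i, a))))
    (F := fun w => w (e none)) (continuous_apply _) (by simpa [q] using hp)
  refine ⟨_, fun i => q (e.symm i), fun i => hq _, fun g hg => ?_⟩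
  obtain ⟨F, hF, hgF⟩ := hclosed.exists_contDiff_extension (g := g) fun x => by
    obtain ⟨i, hi⟩ := hcover x
    obtain ⟨F, hF, hgF⟩ := (hsepgen (col i) ⟨i, rfl⟩ x hi).2 g hg
    refine ⟨fun w => F fun a => w (e (some (col i, a))),
      hF.comp (contDiff_pi.2 fun a => contDiff_apply ℝ ℂ _), ?_⟩
    filter_upwards [hgF] with y hy
    simpa [q] using hy
  exact ⟨F, hF, funext hgF⟩

end IsDiffStructure

/-- Whitney-type embedding theorem for differential spaces: for a differential space `M`,
the following are equivalent: (1) `M` admits a closed smooth embedding into some `ℝⁿ`;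
(2) finitely many elements of `C^∞(M)` generate `C^∞(M)` under composition with smooth
functions `ℂⁿ → ℂ`; (3) there is an `n` such that near each point, `n` locally defined smooth
functions generate all global smooth functions. -/
theorem stmt_0 (M : Type*) [TopologicalSpace M] [T2Space M] [LocallyCompactSpace M]
    [SecondCountableTopology M] (D : Set (M → ℂ)) (hD : IsDiffStructure M D) :
    ((∃ (n : ℕ) (φ : M → (Fin n → ℝ)), IsClosedSmoothEmbedding D (euclD n) φ) ↔
      (∃ (n : ℕ) (f : Fin n → (M → ℂ)), (∀ i, f i ∈ D) ∧
        ∀ g ∈ D, ∃ F : (Fin n → ℂ) → ℂ, ContDiff ℝ (⊤ : ℕ∞) F ∧ g = fun x => F fun i => f i x)) ∧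
    ((∃ (n : ℕ) (f : Fin n → (M → ℂ)), (∀ i, f i ∈ D) ∧
        ∀ g ∈ D, ∃ F : (Fin n → ℂ) → ℂ, ContDiff ℝ (⊤ : ℕ∞) F ∧ g = fun x => F fun i => f i x) ↔
      (∃ n : ℕ, ∀ x : M, ∃ U : Set M, IsOpen U ∧ x ∈ U ∧
        ∃ f : Fin n → (U → ℂ), (∀ i, f i ∈ restrictD D U) ∧
          ∀ g ∈ D, ∃ F : (Fin n → ℂ) → ℂ, ContDiff ℝ (⊤ : ℕ∞) F ∧
            ∀ y : U, g y = F fun i => f i y)) := by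
  refine ⟨⟨?_, ?_⟩, ⟨?_, ?_⟩⟩
  · rintro ⟨n, φ, hφ⟩
    exact ⟨n, IsDiffStructure.exists_generators_of_isClosedSmoothEmbedding hφ⟩
  · rintro ⟨n, f, hf, hgen⟩
    exact hD.exists_isClosedSmoothEmbedding_of_generators hf hgen
  · rintro ⟨n, f, hf, hgen⟩
    refine ⟨n, fun x => ⟨Set.univ, isOpen_univ, trivial, fun i y => f i y, fun i y =>
      ⟨Set.univ, isOpen_univ, trivial, f i, hf i, fun _ _ => rfl⟩, fun g hg => ?_⟩⟩
    obtain ⟨F, hF, rfl⟩ := hgen g hg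
    exact ⟨F, hF, fun _ => rfl⟩
  · rintro ⟨n, hloc⟩
    refine hD.exists_generators_of_local (n := n) fun x => ?_
    obtain ⟨U, hU, hxU, f, hf, hgen⟩ := hloc x
    obtain ⟨f', hf', hff'⟩ := hD.exists_global_of_restrictD hU hxU hf
    refine ⟨_, hff', f', hf', fun g hg => ?_⟩
    obtain ⟨F, hF, hgF⟩ := hgen g hg
    refine ⟨F, hF, ?_⟩
    rintro y ⟨hy, hyf⟩
    rw [hgF ⟨y, hy⟩]
    exact congrArg F (funext fun i => (hyf i).symm)
end

section
/- Let M be a locally finite-dimensional differential space, R ⊆ M × M an equivalence relation on M, π : M → M/R the quotient map, and define C^∞(M/R) := {f : M/R → ℂ : f∘π ∈ C^∞(M)}. Assume that R is a closed subset of M × M and that the first projection R → M, (x,y) ↦ x, is a submersion, where R carries the subspace differential structure from the product M × M. Then M/R equipped with the quotient topology is Hausdorff, locally compact and second countable; C^∞(M/R) is a differential structure on M/R which is locally finite-dimensional; and π : M → M/R is a submersion. -/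
open scoped Topology

/-- The differential structure generated by a family `F` of functions: all functions which
locally agree with some smooth composite `G ∘ (g₁, …, gₙ)` of members of `F`. -/
def generatedD {M : Type*} [TopologicalSpace M] (F : Set (M → ℂ)) : Set (M → ℂ) :=
  {f | ∀ x : M, ∃ U ∈ 𝓝 x, ∃ (n : ℕ) (g : Fin n → (M → ℂ)), (∀ i, g i ∈ F) ∧
    ∃ G : (Fin n → ℂ) → ℂ, ContDiff ℝ (⊤ : ℕ∞) G ∧ ∀ y ∈ U, f y = G fun i => g i y}

/-- The product differential structure on `M₁ × M₂`. -/
def prodD {M₁ M₂ : Type*} [TopologicalSpace M₁] [TopologicalSpace M₂]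
    (D₁ : Set (M₁ → ℂ)) (D₂ : Set (M₂ → ℂ)) : Set (M₁ × M₂ → ℂ) :=
  generatedD ((fun f => f ∘ Prod.fst) '' D₁ ∪ (fun f => f ∘ Prod.snd) '' D₂)

/-- A map between spaces with differential structures is smooth if it pulls back structure
functions to structure functions. -/
def DSmooth {M M' : Type*} (D : Set (M → ℂ)) (D' : Set (M' → ℂ)) (f : M → M') : Prop :=
  ∀ g ∈ D', (g ∘ f) ∈ D

/-- A diffeomorphism between spaces with differential structures: a smooth homeomorphism whose
inverse is smooth. -/
def IsDDiffeomorphism {M M' : Type*} [TopologicalSpace M] [TopologicalSpace M']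
    (D : Set (M → ℂ)) (D' : Set (M' → ℂ)) (f : M → M') : Prop :=
  IsHomeomorph f ∧ DSmooth D D' f ∧ ∀ g ∈ D, ∃ h ∈ D', ∀ x, h (f x) = g x

/-- An open smooth embedding: an open topological embedding which is a diffeomorphism onto
its image (with the restricted differential structure). -/
def IsOpenSmoothEmbedding {M M' : Type*} [TopologicalSpace M] [TopologicalSpace M']
    (D : Set (M → ℂ)) (D' : Set (M' → ℂ)) (f : M → M') : Prop :=
  Topology.IsOpenEmbedding f ∧
  (∀ h ∈ restrictD D' (Set.range f), (fun x => h ⟨f x, Set.mem_range_self x⟩) ∈ D) ∧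
  (∀ g ∈ D, ∃ h ∈ restrictD D' (Set.range f), ∀ x, h ⟨f x, Set.mem_range_self x⟩ = g x)

/-- `f` is a local diffeomorphism at `x` if its restriction to some open neighborhood of `x`
is an open smooth embedding. -/
def IsLocalDiffeoAt {M M' : Type*} [TopologicalSpace M] [TopologicalSpace M']
    (D : Set (M → ℂ)) (D' : Set (M' → ℂ)) (f : M → M') (x : M) : Prop :=
  ∃ U : Set M, IsOpen U ∧ x ∈ U ∧
    IsOpenSmoothEmbedding (restrictD D U) D' (fun y : U => f y)

/-- `f : M → M'` is a submersion at `x` if, together with some smooth `g : M → ℝⁿ`, the map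
`y ↦ (f y, g y)` is a local diffeomorphism at `x`. -/
def DSubmersionAt {M M' : Type*} [TopologicalSpace M] [TopologicalSpace M']
    (D : Set (M → ℂ)) (D' : Set (M' → ℂ)) (f : M → M') (x : M) : Prop :=
  ∃ (n : ℕ) (g : M → (Fin n → ℝ)), DSmooth D (euclD n) g ∧
    IsLocalDiffeoAt D (prodD D' (euclD n)) (fun y => (f y, g y)) x

/-- `f` is a submersion if it is a submersion at every point. -/
def DSubmersion {M M' : Type*} [TopologicalSpace M] [TopologicalSpace M']
    (D : Set (M → ℂ)) (D' : Set (M' → ℂ)) (f : M → M') : Prop :=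
  ∀ x : M, DSubmersionAt D D' f x

/-- A differential space is locally finite-dimensional if every point has an open neighborhood
`U` on which finitely many smooth functions generate `C^∞(U)`. -/
def LocallyFinDimD {M : Type*} [TopologicalSpace M] (D : Set (M → ℂ)) : Prop :=
  ∀ x : M, ∃ U : Set M, IsOpen U ∧ x ∈ U ∧ ∃ (n : ℕ) (f : Fin n → (U → ℂ)),
    (∀ i, f i ∈ restrictD D U) ∧ ∀ g ∈ restrictD D U, ∃ F : (Fin n → ℂ) → ℂ,
      ContDiff ℝ (⊤ : ℕ∞) F ∧ g = fun y => F fun i => f i y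

section Calculus

variable {E F : Type*} [NormedAddCommGroup E] [NormedSpace ℝ E]
  [NormedAddCommGroup F] [NormedSpace ℝ F]

/-- A smooth germ on a finite-dimensional space extends to a globally smooth function. -/
theorem exists_contDiff_eventuallyEq [FiniteDimensional ℝ E] {f : E → F} {c : E}
    (hf : ∀ᶠ x in 𝓝 c, ContDiffAt ℝ (⊤ : ℕ∞) f x) :
    ∃ g : E → F, ContDiff ℝ (⊤ : ℕ∞) g ∧ f =ᶠ[𝓝 c] g := by
  obtain ⟨ε, hε, hball⟩ := Metric.eventually_nhds_iff_ball.1 hf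
  let b : ContDiffBump c := ⟨ε / 4, ε / 2, by positivity, by linarith⟩
  refine ⟨fun x => b x • f x, ?_, ?_⟩
  · rw [contDiff_iff_contDiffAt]
    intro x
    by_cases hx : x ∈ tsupport b
    · refine b.contDiff.contDiffAt.smul (hball x ?_)
      rw [b.tsupport_eq] at hx
      exact Metric.closedBall_subset_ball (show ε / 2 < ε by linarith) hx
    · have h0 : (fun x => b x • f x) =ᶠ[𝓝 x] fun _ => 0 := by
        filter_upwards [notMem_tsupport_iff_eventuallyEq.1 hx] with y hy
        simp [hy]
      exact contDiffAt_const.congr_of_eventuallyEq h0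
  · filter_upwards [b.eventuallyEq_one] with x hx
    simp [hx]

/-- A parametrized inverse function theorem: if `K (c₀, ·)` is the identity near `t₀`, then the
equation `K (c, t) = s` can be solved smoothly and uniquely for `t` near `(c₀, t₀)`. -/
theorem exists_parametric_inverse [CompleteSpace E] [CompleteSpace F] {K : E × F → F}
    (hK : ContDiff ℝ (⊤ : ℕ∞) K) {c₀ : E} {t₀ : F} (hid : ∀ᶠ t in 𝓝 t₀, K (c₀, t) = t) :
    ∃ T : E × F → F, T (c₀, t₀) = t₀ ∧
      (∀ᶠ v in 𝓝 (c₀, t₀), ContDiffAt ℝ (⊤ : ℕ∞) T v ∧ K (v.1, T v) = v.2) ∧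
      ∀ᶠ v in 𝓝 (c₀, t₀), T (v.1, K v) = v.2 := by
  have hn : ((⊤ : ℕ∞) : WithTop ℕ∞) ≠ 0 := by simp
  let Ψ : E × F → E × F := fun v => (v.1, K v)
  have hΨ : ContDiff ℝ (⊤ : ℕ∞) Ψ := contDiff_fst.prodMk hK
  have hKt : K (c₀, t₀) = t₀ := hid.self_of_nhds
  have hΨ₀ : Ψ (c₀, t₀) = (c₀, t₀) := by simp [Ψ, hKt]
  have hKd : HasFDerivAt K (fderiv ℝ K (c₀, t₀)) (c₀, t₀) :=
    (hK.differentiable hn _).hasFDerivAt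
  have hsnd : (fderiv ℝ K (c₀, t₀)).comp (ContinuousLinearMap.inr ℝ E F) =
      ContinuousLinearMap.id ℝ F := by
    have h1 : HasFDerivAt (fun t => K (c₀, t))
        ((fderiv ℝ K (c₀, t₀)).comp (ContinuousLinearMap.inr ℝ E F)) t₀ :=
      HasFDerivAt.comp (f := fun t => (c₀, t)) t₀ hKd (hasFDerivAt_prodMk_right c₀ t₀)
    have h2 : HasFDerivAt (fun t => K (c₀, t)) (ContinuousLinearMap.id ℝ F) t₀ :=
      (hasFDerivAt_id t₀).congr_of_eventuallyEq hid
    exact h1.unique h2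
  let e : (E × F) ≃L[ℝ] (E × F) :=
    (ContinuousLinearEquiv.refl ℝ E).skewProd (ContinuousLinearEquiv.refl ℝ F)
      ((fderiv ℝ K (c₀, t₀)).comp (ContinuousLinearMap.inl ℝ E F))
  have he : HasFDerivAt Ψ (e : E × F →L[ℝ] E × F) (c₀, t₀) := by
    have h1 : HasFDerivAt Ψ ((ContinuousLinearMap.fst ℝ E F).prod (fderiv ℝ K (c₀, t₀)))
        (c₀, t₀) := hasFDerivAt_fst.prodMk hKd
    convert h1 using 1
    refine ContinuousLinearMap.ext fun v => ?_
    have h2 : fderiv ℝ K (c₀, t₀) (0, v.2) = v.2 := by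
      simpa using congrArg (fun L : F →L[ℝ] F => L v.2) hsnd
    have h3 : fderiv ℝ K (c₀, t₀) v =
        fderiv ℝ K (c₀, t₀) (0, v.2) + fderiv ℝ K (c₀, t₀) (v.1, 0) := by
      rw [← map_add]; simp
    rw [h2] at h3
    simp [e, h3]
  let ψ := hΨ.contDiffAt.toOpenPartialHomeomorph Ψ he hn
  have hψ : ∀ v, ψ v = Ψ v := fun _ => rfl
  have hsrc : (c₀, t₀) ∈ ψ.source := hΨ.contDiffAt.mem_toOpenPartialHomeomorph_source he hn
  have htgt : (c₀, t₀) ∈ ψ.target := by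
    have := ψ.map_source hsrc
    rwa [hψ, hΨ₀] at this
  have hsymm₀ : ψ.symm (c₀, t₀) = (c₀, t₀) := by
    have := ψ.left_inv hsrc
    rwa [hψ, hΨ₀] at this
  have hinv : ∀ᶠ v in 𝓝 (c₀, t₀), fderiv ℝ Ψ v ∈
      Set.range ((↑) : ((E × F) ≃L[ℝ] (E × F)) → (E × F →L[ℝ] E × F)) := by
    have hc : ContinuousAt (fderiv ℝ Ψ) (c₀, t₀) := (hΨ.continuous_fderiv hn).continuousAt
    apply hc
    rw [he.fderiv]
    exact ContinuousLinearEquiv.nhds e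
  have hsymm : Filter.Tendsto ψ.symm (𝓝 (c₀, t₀)) (𝓝 (c₀, t₀)) := by
    have := ψ.continuousAt_symm htgt
    rwa [ContinuousAt, hsymm₀] at this
  have hright : ∀ v ∈ ψ.target, (ψ.symm v).1 = v.1 ∧ K (ψ.symm v) = v.2 := fun v hv => by
    have : ((ψ.symm v).1, K (ψ.symm v)) = v := ψ.right_inv hv
    exact Prod.ext_iff.1 this
  refine ⟨fun v => (ψ.symm v).2, congrArg Prod.snd hsymm₀, ?_, ?_⟩
  · filter_upwards [ψ.open_target.mem_nhds htgt, hsymm.eventually hinv] with v hv ⟨e', he'⟩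
    refine ⟨?_, ?_⟩
    · refine contDiff_snd.contDiffAt.comp v (ψ.contDiffAt_symm hv (f₀' := e') ?_ hΨ.contDiffAt)
      rw [he']
      exact (hΨ.differentiable hn _).hasFDerivAt
    · rw [← (hright v hv).1]
      exact (hright v hv).2
  · filter_upwards [ψ.open_source.mem_nhds hsrc] with v hv
    have := ψ.left_inv hv
    rw [hψ] at this
    exact congrArg Prod.snd this

end Calculus

section Germs

/-- The part of the axioms of a differential structure that only concerns algebraic closure and
locality. -/
structure IsSmoothSheaf {X : Type*} [TopologicalSpace X] (D : Set (X → ℂ)) : Prop where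
  comp : ∀ (n : ℕ) (g : Fin n → (X → ℂ)), (∀ i, g i ∈ D) →
    ∀ F : (Fin n → ℂ) → ℂ, ContDiff ℝ (⊤ : ℕ∞) F → (fun x => F fun i => g i x) ∈ D
  locality : ∀ f : X → ℂ,
    (∀ x : X, ∃ U ∈ 𝓝 x, ∃ g ∈ D, ∀ y ∈ U, f y = g y) → f ∈ D

/-- `f` agrees near `x` with an element of `D`. -/
def SmoothGerm {X : Type*} [TopologicalSpace X] (D : Set (X → ℂ)) (f : X → ℂ) (x : X) : Prop :=
  ∃ g ∈ D, f =ᶠ[𝓝 x] g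

/-- `f` is continuous at `x` and pulls back structure functions to smooth germs at `x`. -/
def SmoothMapAt {X Y : Type*} [TopologicalSpace X] [TopologicalSpace Y]
    (D : Set (X → ℂ)) (D' : Set (Y → ℂ)) (f : X → Y) (x : X) : Prop :=
  ContinuousAt f x ∧ ∀ g ∈ D', SmoothGerm D (g ∘ f) x

/-- The smooth complex functions on a normed space. -/
def smoothFunctions (E : Type*) [NormedAddCommGroup E] [NormedSpace ℝ E] : Set (E → ℂ) :=
  {f | ContDiff ℝ (⊤ : ℕ∞) f}

variable {X Y Z : Type*} [TopologicalSpace X] [TopologicalSpace Y] [TopologicalSpace Z]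
  {D : Set (X → ℂ)} {D' : Set (Y → ℂ)} {D'' : Set (Z → ℂ)}

theorem IsDiffStructure.isSmoothSheaf (hD : IsDiffStructure X D) : IsSmoothSheaf D :=
  ⟨hD.comp, hD.locality⟩

theorem IsSmoothSheaf.comp_fintype (hD : IsSmoothSheaf D) {ι : Type*} [Fintype ι]
    {g : ι → X → ℂ} (hg : ∀ i, g i ∈ D) {F : (ι → ℂ) → ℂ} (hF : ContDiff ℝ (⊤ : ℕ∞) F) :
    (fun x => F fun i => g i x) ∈ D := by
  let e := Fintype.equivFin ι
  have h := hD.comp (Fintype.card ι) (fun k => g (e.symm k)) (fun k => hg _)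
    (fun c => F fun i => c (e i)) (hF.comp (contDiff_pi.2 fun i => contDiff_apply ℝ ℂ (e i)))
  simpa using h

theorem IsSmoothSheaf.mem_of_germ (hD : IsSmoothSheaf D) {f : X → ℂ}
    (h : ∀ x, SmoothGerm D f x) : f ∈ D :=
  hD.locality f fun x => by
    obtain ⟨g, hg, he⟩ := h x
    exact ⟨{y | f y = g y}, he, g, hg, fun y hy => hy⟩

theorem smoothGerm_of_mem {f : X → ℂ} (hf : f ∈ D) (x : X) : SmoothGerm D f x :=
  ⟨f, hf, Filter.EventuallyEq.rfl⟩

theorem SmoothGerm.congr {f g : X → ℂ} {x : X} (hf : SmoothGerm D f x) (h : g =ᶠ[𝓝 x] f) :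
    SmoothGerm D g x := by
  obtain ⟨k, hk, he⟩ := hf
  exact ⟨k, hk, h.trans he⟩

theorem IsSmoothSheaf.const_mem (hD : IsSmoothSheaf D) (c : ℂ) : (fun _ => c) ∈ D :=
  hD.comp 0 (fun i => i.elim0) (fun i => i.elim0) (fun _ => c) contDiff_const

theorem IsSmoothSheaf.germ_comp (hD : IsSmoothSheaf D) {ι : Type*} [Fintype ι]
    {g : ι → X → ℂ} {x : X} (hg : ∀ i, SmoothGerm D (g i) x) {F : (ι → ℂ) → ℂ}
    (hF : ContDiff ℝ (⊤ : ℕ∞) F) : SmoothGerm D (fun y => F fun i => g i y) x := by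
  choose k hk he using hg
  refine ⟨_, hD.comp_fintype hk hF, ?_⟩
  filter_upwards [Filter.eventually_all.2 he] with y hy
  simp only [hy]

theorem IsSmoothSheaf.germ_comp_one (hD : IsSmoothSheaf D) {g : X → ℂ} {x : X}
    (hg : SmoothGerm D g x) {F : ℂ → ℂ} (hF : ContDiff ℝ (⊤ : ℕ∞) F) :
    SmoothGerm D (fun y => F (g y)) x :=
  hD.germ_comp (ι := Unit) (g := fun _ => g) (fun _ => hg) (F := fun c => F (c ()))
    (hF.comp (contDiff_apply ℝ ℂ ()))

theorem IsSmoothSheaf.germ_mul (hD : IsSmoothSheaf D) {f g : X → ℂ} {x : X}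
    (hf : SmoothGerm D f x) (hg : SmoothGerm D g x) : SmoothGerm D (fun y => f y * g y) x := by
  have := hD.germ_comp (ι := Bool) (g := fun b => if b then f else g) (x := x)
    (by intro b; cases b <;> simpa) (F := fun c => c true * c false)
    ((contDiff_apply ℝ ℂ true).mul (contDiff_apply ℝ ℂ false))
  simpa using this

theorem IsSmoothSheaf.germ_add (hD : IsSmoothSheaf D) {f g : X → ℂ} {x : X}
    (hf : SmoothGerm D f x) (hg : SmoothGerm D g x) : SmoothGerm D (fun y => f y + g y) x := by
  have := hD.germ_comp (ι := Bool) (g := fun b => if b then f else g) (x := x)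
    (by intro b; cases b <;> simpa) (F := fun c => c true + c false)
    ((contDiff_apply ℝ ℂ true).add (contDiff_apply ℝ ℂ false))
  simpa using this

theorem SmoothMapAt.germ {f : X → Y} {x : X} (hf : SmoothMapAt D D' f x) {g : Y → ℂ}
    (hg : SmoothGerm D' g (f x)) : SmoothGerm D (g ∘ f) x := by
  obtain ⟨k, hk, he⟩ := hg
  exact (hf.2 k hk).congr (hf.1.eventually he)

theorem SmoothMapAt.comp {g : Y → Z} {f : X → Y} {x : X} (hg : SmoothMapAt D' D'' g (f x))
    (hf : SmoothMapAt D D' f x) : SmoothMapAt D D'' (fun y => g (f y)) x :=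
  ⟨ContinuousAt.comp hg.1 hf.1, fun k hk => hf.germ (hg.2 k hk)⟩

theorem smoothMapAt_id (x : X) : SmoothMapAt D D (fun y => y) x :=
  ⟨continuousAt_id, fun _ hg => smoothGerm_of_mem hg x⟩

theorem smoothMapAt_const (hD : IsSmoothSheaf D) (x : X) (y : Y) :
    SmoothMapAt D D' (fun _ => y) x :=
  ⟨continuousAt_const, fun g _ => smoothGerm_of_mem (hD.const_mem (g y)) x⟩

theorem subset_generatedD (A : Set (X → ℂ)) : A ⊆ generatedD A := fun f hf _ =>
  ⟨Set.univ, Filter.univ_mem, 1, fun _ => f, fun _ => hf, fun c => c 0, contDiff_apply ℝ ℂ 0,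
    fun _ _ => rfl⟩

theorem isSmoothSheaf_generatedD (A : Set (X → ℂ)) : IsSmoothSheaf (generatedD A) where
  comp n f hf F hF x := by
    choose U hU m g hg G hG he using fun i => hf i x
    let e := Fintype.equivFin (Σ i, Fin (m i))
    let γ : (Σ i, Fin (m i)) → X → ℂ := fun s => g s.1 s.2
    refine ⟨⋂ i, U i, Filter.iInter_mem.2 hU, _, fun k => γ (e.symm k), fun k => hg _ _,
      fun c => F fun i => G i fun j => c (e ⟨i, j⟩), ?_, fun y hy => ?_⟩
    · exact hF.comp (contDiff_pi.2 fun i => (hG i).comp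
        (contDiff_pi.2 fun j => contDiff_apply ℝ ℂ _))
    · rw [Set.mem_iInter] at hy
      simp only [he _ y (hy _), e.symm_apply_apply, γ]
  locality f hf x := by
    obtain ⟨U, hU, g, hg, he⟩ := hf x
    obtain ⟨V, hV, n, k, hk, G, hG, he'⟩ := hg x
    exact ⟨U ∩ V, Filter.inter_mem hU hV, n, k, hk, G, hG, fun y hy =>
      (he y hy.1).trans (he' y hy.2)⟩

theorem isSmoothSheaf_prodD (D : Set (X → ℂ)) (D' : Set (Y → ℂ)) :
    IsSmoothSheaf (prodD D D') :=
  isSmoothSheaf_generatedD _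

theorem smoothMapAt_fst (z : X × Y) : SmoothMapAt (prodD D D') D (fun w => w.1) z :=
  ⟨continuousAt_fst, fun g hg =>
    smoothGerm_of_mem (subset_generatedD _ (Or.inl ⟨g, hg, rfl⟩)) z⟩

theorem smoothMapAt_snd (z : X × Y) : SmoothMapAt (prodD D D') D' (fun w => w.2) z :=
  ⟨continuousAt_snd, fun g hg =>
    smoothGerm_of_mem (subset_generatedD _ (Or.inr ⟨g, hg, rfl⟩)) z⟩

theorem SmoothMapAt.prodMk (hD : IsSmoothSheaf D) {f : X → Y} {g : X → Z} {x : X}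
    (hf : SmoothMapAt D D' f x) (hg : SmoothMapAt D D'' g x) :
    SmoothMapAt D (prodD D' D'') (fun y => (f y, g y)) x := by
  have hc : ContinuousAt (fun y => (f y, g y)) x := hf.1.prodMk hg.1
  refine ⟨hc, fun k hk => ?_⟩
  obtain ⟨U, hU, n, a, ha, G, hG, he⟩ := hk (f x, g x)
  have h : ∀ i, SmoothGerm D (fun y => a i (f y, g y)) x := fun i => by
    rcases ha i with ⟨b, hb, hab⟩ | ⟨b, hb, hab⟩
    · rw [← hab]; exact hf.2 b hb
    · rw [← hab]; exact hg.2 b hb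
  refine (hD.germ_comp h hG).congr ?_
  filter_upwards [hc hU] with y hy
  exact he _ hy

theorem slice_mem (hD' : IsSmoothSheaf D') {f : X × Y → ℂ} (hf : f ∈ prodD D D') (x : X) :
    (fun y => f (x, y)) ∈ D' :=
  hD'.mem_of_germ fun y =>
    (SmoothMapAt.prodMk (D' := D) hD' (smoothMapAt_const hD' y x) (smoothMapAt_id y)).2 f hf

theorem smoothMapAt_val (A : Set X) (a : A) :
    SmoothMapAt (restrictD D A) D (fun y : A => (y : X)) a :=
  ⟨continuous_subtype_val.continuousAt, fun g hg => smoothGerm_of_mem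
    (fun _ => ⟨Set.univ, isOpen_univ, trivial, g, hg, fun _ _ => rfl⟩) a⟩

theorem mem_restrictD_iff {A : Set X} {f : A → ℂ} :
    f ∈ restrictD D A ↔ ∀ x : A, ∃ g ∈ D, ∀ᶠ y in 𝓝 (x : X), ∀ h : y ∈ A, f ⟨y, h⟩ = g y := by
  refine forall_congr' fun x => ⟨?_, ?_⟩
  · rintro ⟨U, hU, hx, g, hg, he⟩
    exact ⟨g, hg, Filter.eventually_of_mem (hU.mem_nhds hx) fun y hy h => he ⟨y, h⟩ hy⟩
  · rintro ⟨g, hg, he⟩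
    obtain ⟨U, hU, hUo, hx⟩ := eventually_nhds_iff.1 he
    exact ⟨U, hUo, hx, g, hg, fun y hy => hU y hy y.2⟩

section Normed

variable {E F : Type*} [NormedAddCommGroup E] [NormedSpace ℝ E]
  [NormedAddCommGroup F] [NormedSpace ℝ F]

theorem smoothMapAt_of_contDiffAt [FiniteDimensional ℝ E] {f : E → F} {c : E}
    (hf : ∀ᶠ x in 𝓝 c, ContDiffAt ℝ (⊤ : ℕ∞) f x) :
    SmoothMapAt (smoothFunctions E) (smoothFunctions F) f c := by
  obtain ⟨g, hg, he⟩ := exists_contDiff_eventuallyEq hf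
  exact ⟨hf.self_of_nhds.continuousAt, fun k hk =>
    ⟨k ∘ g, ContDiff.comp (show ContDiff ℝ (⊤ : ℕ∞) k from hk) hg, he.fun_comp k⟩⟩

theorem smoothMapAt_of_coord (hD : IsSmoothSheaf D) [FiniteDimensional ℝ E] {f : X → E} {x : X}
    (hc : ContinuousAt f x)
    (hf : ∀ l : E →L[ℝ] ℝ, SmoothGerm D (fun y => (l (f y) : ℂ)) x) :
    SmoothMapAt D (smoothFunctions E) f x := by
  refine ⟨hc, fun g hg => ?_⟩
  let e : E ≃L[ℝ] (Fin (Module.finrank ℝ E) → ℝ) := ContinuousLinearEquiv.ofFinrankEq (by simp)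
  have h := hD.germ_comp
    (fun i => hf ((ContinuousLinearMap.proj i).comp (e : E →L[ℝ] (Fin _ → ℝ))))
    (F := fun c => g (e.symm fun i => (c i).re))
    (ContDiff.comp hg (e.symm.contDiff.comp (contDiff_pi.2 fun i =>
      Complex.reCLM.contDiff.comp (contDiff_apply ℝ ℂ i))))
  refine h.congr (Filter.Eventually.of_forall fun y => ?_)
  simp only [Function.comp_apply, ContinuousLinearMap.comp_apply, ContinuousLinearMap.proj_apply,
    Complex.ofReal_re]
  congr 1
  exact (e.symm_apply_apply (f y)).symm

theorem contDiff_ofReal : ContDiff ℝ (⊤ : ℕ∞) (fun r : ℝ => (r : ℂ)) :=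
  Complex.ofRealCLM.contDiff

theorem SmoothMapAt.prodMk_normed (hD : IsSmoothSheaf D) [FiniteDimensional ℝ E]
    [FiniteDimensional ℝ F] {f : X → E} {g : X → F} {x : X}
    (hf : SmoothMapAt D (smoothFunctions E) f x) (hg : SmoothMapAt D (smoothFunctions F) g x) :
    SmoothMapAt D (smoothFunctions (E × F)) (fun y => (f y, g y)) x := by
  refine smoothMapAt_of_coord hD (hf.1.prodMk hg.1) fun l => ?_
  have h1 := hf.2 (fun v => (l (v, 0) : ℂ)) (contDiff_ofReal.comp
    (l.comp (ContinuousLinearMap.inl ℝ E F)).contDiff)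
  have h2 := hg.2 (fun v => (l (0, v) : ℂ)) (contDiff_ofReal.comp
    (l.comp (ContinuousLinearMap.inr ℝ E F)).contDiff)
  refine (hD.germ_add h1 h2).congr (Filter.Eventually.of_forall fun y => ?_)
  simp only [Function.comp_apply]
  rw [← Complex.ofReal_add, ← map_add]
  simp

theorem smoothMapAt_pi_complex (hD : IsSmoothSheaf D) {ι : Type*} [Fintype ι] {f : X → ι → ℂ}
    {x : X} (hc : ContinuousAt f x) (hf : ∀ i, SmoothGerm D (fun y => f y i) x) :
    SmoothMapAt D (smoothFunctions (ι → ℂ)) f x :=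
  ⟨hc, fun _ hg => hD.germ_comp hf hg⟩

theorem smoothMapAt_pi_real (hD : IsSmoothSheaf D) {ι : Type*} [Fintype ι] {f : X → ι → ℝ}
    {x : X} (hc : ContinuousAt f x) (hf : ∀ i, SmoothGerm D (fun y => (f y i : ℂ)) x) :
    SmoothMapAt D (smoothFunctions (ι → ℝ)) f x :=
  ⟨hc, fun g hg => hD.germ_comp hf (F := fun c => g fun i => (c i).re)
    (ContDiff.comp (show ContDiff ℝ (⊤ : ℕ∞) g from hg)
      (contDiff_pi.2 fun i => Complex.reCLM.contDiff.comp (contDiff_apply ℝ ℂ i)))⟩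

end Normed

end Germs

section LocalDiffeo

variable {X Y : Type*} [TopologicalSpace X] [TopologicalSpace Y]
  {D : Set (X → ℂ)} {D' : Set (Y → ℂ)}

/-- A local diffeomorphism is continuous and has a smooth local inverse. -/
theorem IsLocalDiffeoAt.exists_local_inverse {f : X → Y} {x : X}
    (hf : IsLocalDiffeoAt D D' f x) :
    ContinuousAt f x ∧ ∃ τ : Y → X, τ (f x) = x ∧
      (∀ᶠ y in 𝓝 (f x), f (τ y) = y ∧ SmoothMapAt D' D τ y) ∧ ∀ᶠ z in 𝓝 x, τ (f z) = z := by
  classical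
  obtain ⟨U, hU, hx, hemb, -, hext⟩ := hf
  let τ : Y → X := fun y => if h : ∃ u : U, f u = y then h.choose else x
  have hτ : ∀ u : U, τ (f u) = u := fun u => by
    have h : ∃ v : U, f v = f u := ⟨u, rfl⟩
    simp only [τ, dif_pos h]
    exact congrArg Subtype.val (hemb.injective h.choose_spec)
  refine ⟨(hU.isOpenEmbedding_subtypeVal.continuousAt_iff (x := ⟨x, hx⟩)).1
    hemb.continuous.continuousAt, τ, hτ ⟨x, hx⟩, ?_,
    Filter.eventually_of_mem (hU.mem_nhds hx) fun z hz => hτ ⟨z, hz⟩⟩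
  filter_upwards [hemb.isOpen_range.mem_nhds ⟨⟨x, hx⟩, rfl⟩]
  rintro _ ⟨u, rfl⟩
  refine ⟨by simp only [hτ], ?_, fun g hg => ?_⟩
  · simp only [ContinuousAt, hτ]
    rw [← hemb.map_nhds_eq u, Filter.tendsto_map'_iff]
    exact (continuous_subtype_val.tendsto u).congr fun v => (hτ v).symm
  · obtain ⟨h, hh, he⟩ := hext (fun u => g u) (fun _ => ⟨Set.univ, isOpen_univ, trivial, g, hg,
      fun _ _ => rfl⟩)
    obtain ⟨V, hV, huV, k, hk, hkV⟩ := hh ⟨f u, u, rfl⟩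
    refine ⟨k, hk, ?_⟩
    filter_upwards [hV.mem_nhds huV, hemb.isOpen_range.mem_nhds ⟨u, rfl⟩]
    rintro _ hv ⟨v, rfl⟩
    rw [← hkV ⟨f v, v, rfl⟩ hv, he v]
    simp only [Function.comp_apply, hτ]

/-- An injective smooth map with smooth local inverses at all points is an open smooth
embedding. -/
theorem isOpenSmoothEmbedding_of_local_inverse {f : X → Y} {V : Set X} (hV : IsOpen V)
    (hinj : Set.InjOn f V) (hsm : ∀ x ∈ V, SmoothMapAt D D' f x)
    (hinv : ∀ x ∈ V, ∃ τ : Y → X, SmoothMapAt D' D τ (f x) ∧ (∀ᶠ z in 𝓝 x, τ (f z) = z) ∧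
      ∀ᶠ y in 𝓝 (f x), f (τ y) = y) :
    IsOpenSmoothEmbedding (restrictD D V) D' (fun x : V => f x) := by
  classical
  have hinj' : Function.Injective (fun x : V => f x) := fun a b h => Subtype.ext
    (hinj a.2 b.2 h)
  have hmap : ∀ x ∈ V, 𝓝 (f x) ≤ Filter.map f (𝓝 x) := fun x hx => by
    obtain ⟨τ, hτ, hl, hr⟩ := hinv x hx
    have ht : Filter.Tendsto τ (𝓝 (f x)) (𝓝 x) := by
      have := hτ.1
      rwa [ContinuousAt, hl.self_of_nhds] at this
    calc 𝓝 (f x) = Filter.map (fun y => f (τ y)) (𝓝 (f x)) := by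
          rw [Filter.map_congr hr]; exact Filter.map_id.symm
      _ = Filter.map f (Filter.map τ (𝓝 (f x))) := Filter.map_map.symm
      _ ≤ Filter.map f (𝓝 x) := Filter.map_mono ht
  have hemb : Topology.IsOpenEmbedding (fun x : V => f x) := by
    refine Topology.IsOpenEmbedding.of_continuous_injective_isOpenMap
      (continuous_iff_continuousAt.2 fun x =>
        ContinuousAt.comp (f := ((↑) : V → X)) (hsm x x.2).1 continuous_subtype_val.continuousAt)
      hinj' (IsOpenMap.of_nhds_le fun x => ?_)
    have h := hmap x x.2
    rw [← hV.isOpenEmbedding_subtypeVal.map_nhds_eq x, Filter.map_map] at h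
    exact h
  refine ⟨hemb, fun h hh => mem_restrictD_iff.2 fun x => ?_, fun g hg => ?_⟩
  · obtain ⟨k, hk, he⟩ := mem_restrictD_iff.1 hh ⟨f x, x, rfl⟩
    obtain ⟨k', hk', he'⟩ := (hsm x x.2).2 k hk
    refine ⟨k', hk', ?_⟩
    filter_upwards [he', (hsm x x.2).1.eventually he] with y hy hy' hyV
    rw [← hy]
    exact hy' ⟨⟨y, hyV⟩, rfl⟩
  · refine ⟨fun y => g y.2.choose, mem_restrictD_iff.2 ?_, fun x => ?_⟩
    · rintro ⟨_, x, rfl⟩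
      obtain ⟨τ, hτ, hl, hr⟩ := hinv x x.2
      obtain ⟨k, hk, he⟩ := mem_restrictD_iff.1 hg x
      obtain ⟨k', hk', he'⟩ := hτ.2 k hk
      refine ⟨k', hk', ?_⟩
      have hnx : (fun z : V => f z) '' {z : V | τ (f z) = z ∧ ∀ h : (z : X) ∈ V, g ⟨z, h⟩ = k z} ∈
          𝓝 (f x) := hemb.isOpenMap.image_mem_nhds
        (continuous_subtype_val.continuousAt.eventually (hl.and he))
      filter_upwards [he', hnx]
      rintro _ hy ⟨z, ⟨hz, hz'⟩, rfl⟩ hzr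
      have hc : (hzr.choose : V) = z := hinj' hzr.choose_spec
      rw [← hy]
      simp only [hc, Function.comp_apply, hz]
      exact hz' z.2
    · exact congrArg g
        (hinj' (Exists.choose_spec (⟨x, rfl⟩ : f x ∈ Set.range fun x : V => f x)))

end LocalDiffeo

section Bump

variable {X : Type*} [TopologicalSpace X]

/-- A function which is positive on a punctured neighborhood of a zero `x` can be cut off to a
bump function at `x` by post-composing it with a smooth function. -/
theorem exists_bump [T2Space X] [LocallyCompactSpace X] {q : X → ℝ} {x : X} {O : Set X}
    (hO : IsOpen O) (hx : x ∈ O) (hq : ContinuousOn q O) (hqx : q x = 0)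
    (hpos : ∀ y ∈ O, y ≠ x → 0 < q y) {U : Set X} (hU : U ∈ 𝓝 x) :
    ∃ (K : Set X) (χ : X → ℂ) (β : ℝ → ℝ), IsCompact K ∧ K ⊆ U ∩ O ∧ ContDiff ℝ (⊤ : ℕ∞) β ∧
      (∀ y ∈ K, χ =ᶠ[𝓝 y] fun z => (β (q z) : ℂ)) ∧ (∀ y ∉ K, χ =ᶠ[𝓝 y] fun _ => 0) ∧
      χ =ᶠ[𝓝 x] fun _ => 1 := by
  classical
  obtain ⟨K, hKx, hKU, hK⟩ := local_compact_nhds (Filter.inter_mem hU (hO.mem_nhds hx))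
  have hKO : K ⊆ O := fun y hy => (hKU hy).2
  have hxK : x ∈ interior K := mem_interior_iff_mem_nhds.2 hKx
  obtain ⟨ε, hε, hbd⟩ := (hK.diff isOpen_interior).exists_forall_le'
    (hq.mono fun y hy => hKO hy.1) (a := 0)
    fun y hy => hpos y (hKO hy.1) fun h => hy.2 (h ▸ hxK)
  let β : ℝ → ℝ := fun t => Real.smoothTransition (2 - 3 * t / ε)
  have hβ1 : ∀ t ≤ ε / 3, β t = 1 := fun t ht => by
    refine Real.smoothTransition.one_of_one_le ?_
    have : 3 * t / ε ≤ 1 := by rw [div_le_one hε]; linarith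
    linarith
  have hβ0 : ∀ t, 2 * ε / 3 ≤ t → β t = 0 := fun t ht => by
    refine Real.smoothTransition.zero_of_nonpos ?_
    have : 2 ≤ 3 * t / ε := by rw [le_div_iff₀ hε]; linarith
    linarith
  let χ : X → ℂ := fun y => if y ∈ interior K then (β (q y) : ℂ) else 0
  have hχ : ∀ y ∈ interior K, χ =ᶠ[𝓝 y] fun z => (β (q z) : ℂ) := fun y hy => by
    filter_upwards [isOpen_interior.mem_nhds hy] with z hz
    simp only [χ, if_pos hz]
  have hqc : ∀ y ∈ O, ContinuousAt q y := fun y hy => hq.continuousAt (hO.mem_nhds hy)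
  refine ⟨K, χ, β, hK, hKU, ?_, fun y hy => ?_, fun y hy => ?_, ?_⟩
  · exact Real.smoothTransition.contDiff.comp
      (contDiff_const.sub ((contDiff_const.mul contDiff_id).div_const ε))
  · by_cases hyK : y ∈ interior K
    · exact hχ y hyK
    · have h1 : ∀ᶠ z in 𝓝 y, 2 * ε / 3 < q z :=
        (hqc y (hKO hy)).eventually (lt_mem_nhds (by linarith [hbd y ⟨hy, hyK⟩]))
      filter_upwards [h1] with z hz
      simp [χ, hβ0 _ hz.le]
  · filter_upwards [hK.isClosed.isOpen_compl.mem_nhds hy] with z hz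
    exact if_neg fun h => hz (interior_subset h)
  · have h1 : ∀ᶠ z in 𝓝 x, q z < ε / 3 := (hqc x hx).eventually (gt_mem_nhds (by
      rw [hqx]; positivity))
    filter_upwards [hχ x hxK, h1] with z hz hz'
    simp [hz, hβ1 _ hz'.le]

end Bump

section FiniteDimensional

variable {X : Type*} [TopologicalSpace X] {D : Set (X → ℂ)}

theorem LocallyFinDimD.exists_generators (hfd : LocallyFinDimD D) (x : X) :
    ∃ (m : ℕ) (φ : X → Fin m → ℂ), (∀ i, (fun y => φ y i) ∈ D) ∧ ∃ U : Set X, IsOpen U ∧ x ∈ U ∧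
      ∀ f ∈ D, ∃ F : (Fin m → ℂ) → ℂ, ContDiff ℝ (⊤ : ℕ∞) F ∧ ∀ y ∈ U, f y = F (φ y) := by
  obtain ⟨U, hU, hx, m, f, hf, hgen⟩ := hfd x
  choose V hV hxV g hg he using fun i => hf i ⟨x, hx⟩
  refine ⟨m, fun y i => g i y, hg, U ∩ ⋂ i, V i, hU.inter (isOpen_iInter_of_finite hV),
    ⟨hx, Set.mem_iInter.2 hxV⟩, fun k hk => ?_⟩
  obtain ⟨F, hF, hkF⟩ := hgen (fun y => k y) fun _ =>
    ⟨Set.univ, isOpen_univ, trivial, k, hk, fun _ _ => rfl⟩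
  refine ⟨F, hF, fun y hy => ?_⟩
  rw [congrFun hkF ⟨y, hy.1⟩]
  congr 1
  funext i
  exact he i ⟨y, hy.1⟩ (Set.mem_iInter.1 hy.2 i)

/-- If finitely many structure functions generate the structure near each point and there are
bump functions, then the space is locally finite-dimensional. -/
theorem locallyFinDimD_of_generators [T2Space X] (hD : IsDiffStructure X D)
    (hgen : ∀ x : X, ∃ (m : ℕ) (φ : X → Fin m → ℂ), (∀ i, (fun y => φ y i) ∈ D) ∧
      ∃ U : Set X, IsOpen U ∧ x ∈ U ∧
      ∀ f ∈ D, ∃ F : (Fin m → ℂ) → ℂ, ContDiff ℝ (⊤ : ℕ∞) F ∧ ∀ y ∈ U, f y = F (φ y))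
    (hbump : ∀ x : X, ∀ U ∈ 𝓝 x, ∃ χ ∈ D, ∃ K, IsCompact K ∧ K ⊆ U ∧ (∀ y ∉ K, χ y = 0) ∧
      χ =ᶠ[𝓝 x] fun _ => 1) :
    LocallyFinDimD D := by
  intro x
  obtain ⟨m, φ, hφ, U, hU, hxU, hF⟩ := hgen x
  obtain ⟨χ, hχ, K, hK, hKU, hχ0, hχ1⟩ := hbump x U (hU.mem_nhds hxU)
  have hS := hD.isSmoothSheaf
  have hχc := hD.continuous χ hχ
  have hφc : Continuous φ := continuous_pi fun i => hD.continuous _ (hφ i)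
  let U' : Set X := {y | χ y ≠ 0}
  have hU' : IsOpen U' := isOpen_ne_fun hχc continuous_const
  have hU'K : U' ⊆ K := fun y hy => by
    by_contra h
    exact hy (hχ0 y h)
  have hinj : Set.InjOn φ U := fun a ha b hb hab => by
    by_contra hne
    obtain ⟨f, hf, hfab⟩ := hD.separates a b hne
    obtain ⟨F, -, hFf⟩ := hF f hf
    exact hfab (by rw [hFf a ha, hFf b hb, hab])
  let ι : X → Fin (m + 1) → ℂ := fun y => Fin.cons (χ y)⁻¹ (φ y)
  have htail : ∀ y, Fin.tail (ι y) = φ y := fun y => Fin.tail_cons _ _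
  have htailc : Continuous (Fin.tail : (Fin (m + 1) → ℂ) → Fin m → ℂ) :=
    continuous_pi fun i => continuous_apply i.succ
  have htails : ContDiff ℝ (⊤ : ℕ∞) (Fin.tail : (Fin (m + 1) → ℂ) → Fin m → ℂ) :=
    contDiff_pi.2 fun i => contDiff_apply ℝ ℂ i.succ
  refine ⟨U', hU', by simp [U', hχ1.self_of_nhds], m + 1, fun i y => ι y i, fun i => ?_,
    fun g hg => ?_⟩
  · rw [mem_restrictD_iff]
    intro y
    have hgerm : SmoothGerm D (fun z => ι z i) y := by
      refine Fin.cases ?_ (fun j => ?_) i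
      · have hy : χ y ≠ 0 := y.2
        obtain ⟨k, hk, he⟩ := exists_contDiff_eventuallyEq (f := fun c : ℂ => c⁻¹) (c := χ y)
          ((eventually_ne_nhds hy).mono fun c hc => contDiffAt_inv ℝ hc)
        exact (hS.germ_comp_one (smoothGerm_of_mem hχ _) hk).congr
          (hχc.continuousAt.eventually he)
      · exact smoothGerm_of_mem (hφ j) _
    obtain ⟨k, hk, he⟩ := hgerm
    exact ⟨k, hk, he.mono fun z hz _ => hz⟩
  · have hclosed : IsClosed {w : Fin (m + 1) → ℂ | ∃ y ∈ K, φ y = Fin.tail w ∧ w 0 * χ y = 1} := by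
      have : CompactSpace K := isCompact_iff_compactSpace.1 hK
      have hC : IsClosed
          {p : K × (Fin (m + 1) → ℂ) | φ p.1 = Fin.tail p.2 ∧ p.2 0 * χ p.1 = 1} := by
        refine IsClosed.inter (isClosed_eq ?_ ?_) (isClosed_eq ?_ continuous_const)
        · exact hφc.comp (continuous_subtype_val.comp continuous_fst)
        · exact htailc.comp continuous_snd
        · exact ((continuous_apply 0).comp continuous_snd).mul
            (hχc.comp (continuous_subtype_val.comp continuous_fst))
      convert isClosedMap_snd_of_compactSpace _ hC using 1
      ext w
      constructor
      · rintro ⟨y, hy, h⟩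
        exact ⟨(⟨y, hy⟩, w), h, rfl⟩
      · rintro ⟨⟨y, _⟩, h, rfl⟩
        exact ⟨y, y.2, h⟩
    have hιmem : ∀ y ∈ U', ι y ∈ {w : Fin (m + 1) → ℂ | ∃ y ∈ K, φ y = Fin.tail w ∧
        w 0 * χ y = 1} := fun y hy =>
      ⟨y, hU'K hy, (htail y).symm, inv_mul_cancel₀ hy⟩
    obtain ⟨F, hFmem⟩ := exists_contMDiffMap_forall_mem_convex_of_local
      (modelWithCornersSelf ℝ (Fin (m + 1) → ℂ)) (n := (⊤ : ℕ∞)) (F := ℂ)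
      (t := fun w => {a | ∀ y : U', ι y = w → a = g y})
      (fun w a ha b hb s r _ _ hsr y hy => by
        rw [ha y hy, hb y hy, ← add_smul, hsr, one_smul])
      (fun w => by
        by_cases hw : w ∈ {w : Fin (m + 1) → ℂ | ∃ y ∈ K, φ y = Fin.tail w ∧ w 0 * χ y = 1}
        · obtain ⟨y, hyK, hφy, hχy⟩ := hw
          have hyU' : y ∈ U' := fun h => by simp [h] at hχy
          obtain ⟨A, hA, hyA, k, hk, hgk⟩ := hg ⟨y, hyU'⟩
          obtain ⟨F₀, hF₀, hkF₀⟩ := hF k hk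
          have hN : IsClosed (Fin.tail ⁻¹' (φ '' (K \ A)) : Set (Fin (m + 1) → ℂ)) :=
            ((hK.diff hA).image hφc).isClosed.preimage htailc
          refine ⟨_, hN.isOpen_compl.mem_nhds ?_, fun w => F₀ (Fin.tail w),
            ((hF₀.comp htails).contMDiff).contMDiffOn, ?_⟩
          · rintro ⟨z, hz, hzw⟩
            have : z = y := hinj (hKU hz.1) (hKU hyK) (hzw.trans hφy.symm)
            exact hz.2 (this ▸ hyA)
          · rintro v hv z rfl
            have hzA : (z : X) ∈ A := by
              by_contra h
              exact hv ⟨z, ⟨hU'K z.2, h⟩, (htail z).symm⟩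
            rw [hgk z hzA, hkF₀ z (hKU (hU'K z.2))]
            exact congrArg F₀ (htail z)
        · refine ⟨_, hclosed.isOpen_compl.mem_nhds hw, fun _ => 0, contMDiffOn_const, ?_⟩
          rintro v hv z rfl
          exact absurd (hιmem z z.2) hv)
    refine ⟨F, F.contMDiff.contDiff, funext fun y => ?_⟩
    exact (hFmem (ι y) y rfl).symm

end FiniteDimensional

section AdaptedChart

variable {M : Type*} [TopologicalSpace M] {D : Set (M → ℂ)} {S : Setoid M}

/-- A submersive equivalence relation has smooth local sections through each of its points. -/
theorem exists_local_section (hD : IsDiffStructure M D)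
    (hsub : DSubmersion (restrictD (prodD D D) {p : M × M | S.r p.1 p.2}) D
      (fun p : {p : M × M | S.r p.1 p.2} => (p : M × M).1))
    {x y : M} (h : S.r x y) :
    ∃ s : M → M, s x = y ∧ SmoothMapAt D D s x ∧ ∀ᶠ z in 𝓝 x, S.r z (s z) := by
  obtain ⟨n, g, -, hloc⟩ := hsub ⟨(x, y), h⟩
  obtain ⟨-, τ, hτ, hinv, -⟩ := hloc.exists_local_inverse
  have hmk : ContinuousAt (fun z => (z, g ⟨(x, y), h⟩)) x := by fun_prop
  refine ⟨fun z => (τ (z, g ⟨(x, y), h⟩)).1.2, 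
    congrArg (fun r : {p : M × M | S.r p.1 p.2} => r.1.2) hτ, ?_, ?_⟩
  · refine SmoothMapAt.comp (smoothMapAt_snd (D := D) _)
      (SmoothMapAt.comp (smoothMapAt_val _ _) ?_)
    exact SmoothMapAt.comp (g := τ) (f := fun z => (z, g ⟨(x, y), h⟩)) hinv.self_of_nhds.2
      (SmoothMapAt.prodMk hD.isSmoothSheaf (smoothMapAt_id x)
        (smoothMapAt_const hD.isSmoothSheaf x _))
  · filter_upwards [hmk.eventually hinv] with z hz
    have h1 : (τ (z, g ⟨(x, y), h⟩)).1.1 = z := congrArg Prod.fst hz.1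
    have h2 := (τ (z, g ⟨(x, y), h⟩)).2
    rw [Set.mem_ofPred_eq, h1] at h2
    exact h2

/-- In terms of local generators, germs of functions on `M × ℝⁿ` are smooth functions of the
coordinates. -/
theorem exists_eventuallyEq_of_generators {n m : ℕ} {φ : M → Fin m → ℂ} {U : Set M}
    (hU : IsOpen U)
    (hgen : ∀ f ∈ D, ∃ F : (Fin m → ℂ) → ℂ, ContDiff ℝ (⊤ : ℕ∞) F ∧ ∀ y ∈ U, f y = F (φ y))
    {x : M} (hx : x ∈ U) {t : Fin n → ℝ} {f : M × (Fin n → ℝ) → ℂ}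
    (hf : SmoothGerm (prodD D (euclD n)) f (x, t)) :
    ∃ F : (Fin m → ℂ) × (Fin n → ℝ) → ℂ, ContDiff ℝ (⊤ : ℕ∞) F ∧
      ∀ᶠ v in 𝓝 (x, t), f v = F (φ v.1, v.2) := by
  obtain ⟨k, hk, he⟩ := hf
  obtain ⟨V, hV, d, a, ha, G, hG, hkG⟩ := hk (x, t)
  have h : ∀ i, ∃ F : (Fin m → ℂ) × (Fin n → ℝ) → ℂ, ContDiff ℝ (⊤ : ℕ∞) F ∧
      ∀ v : M × (Fin n → ℝ), v.1 ∈ U → a i v = F (φ v.1, v.2) := fun i => by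
    rcases ha i with ⟨b, hb, hab⟩ | ⟨b, hb, hab⟩
    · obtain ⟨F, hF, hbF⟩ := hgen b hb
      exact ⟨fun w => F w.1, hF.comp contDiff_fst, fun v hv => by rw [← hab]; exact hbF _ hv⟩
    · exact ⟨fun w => b w.2, ContDiff.comp (show ContDiff ℝ (⊤ : ℕ∞) b from hb) contDiff_snd,
        fun v _ => by rw [← hab]; rfl⟩
  choose F hF haF using h
  refine ⟨fun w => G fun i => F i w, hG.comp (contDiff_pi.2 hF), ?_⟩
  filter_upwards [he, hV, continuousAt_fst.eventually (hU.mem_nhds hx)] with v h1 h2 h3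
  rw [h1, hkG v h2]
  congr 1
  funext i
  exact haF i v h3

/-- Near each point `x₀`, a submersive equivalence relation is parametrized by pairs `(z, s)` of a
point `z` and the coordinates `s = p w` of a point `w = Θ (z, s)` equivalent to `z`. -/
theorem exists_adapted_chart (hD : IsDiffStructure M D) (hfd : LocallyFinDimD D)
    (hsub : DSubmersion (restrictD (prodD D D) {p : M × M | S.r p.1 p.2}) D
      (fun p : {p : M × M | S.r p.1 p.2} => (p : M × M).1)) (x₀ : M) :
    ∃ (n : ℕ) (p : M → Fin n → ℝ) (Θ : M × (Fin n → ℝ) → M),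
      (∀ j, (fun y => (p y j : ℂ)) ∈ D) ∧ Θ (x₀, p x₀) = x₀ ∧
      (∀ᶠ v in 𝓝 (x₀, p x₀), SmoothMapAt (prodD D (euclD n)) D Θ v ∧ S.r v.1 (Θ v) ∧
        p (Θ v) = v.2) ∧
      ∀ᶠ v in 𝓝 (x₀, x₀), S.r v.1 v.2 → Θ (v.1, p v.2) = v.2 := by
  have hS := hD.isSmoothSheaf
  obtain ⟨n, g, hg, hloc⟩ := hsub ⟨(x₀, x₀), S.refl' x₀⟩
  obtain ⟨hfc, τ, hτ, hinv, hleft⟩ := hloc.exists_local_inverse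
  set r₀ : {p : M × M | S.r p.1 p.2} := ⟨(x₀, x₀), S.refl' x₀⟩ with hr₀
  set t₀ := g r₀ with ht₀
  change τ (x₀, t₀) = r₀ at hτ
  change ∀ᶠ v in 𝓝 (x₀, t₀), _ at hinv
  let σ : M × (Fin n → ℝ) → M := fun v => (τ v).1.2
  have hσ : ∀ v, SmoothMapAt (prodD D (euclD n)) (restrictD (prodD D D) _) τ v →
      SmoothMapAt (prodD D (euclD n)) D σ v := fun v hv =>
    SmoothMapAt.comp (smoothMapAt_snd _) (SmoothMapAt.comp (smoothMapAt_val _ _) hv)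
  have hσ₀ : σ (x₀, t₀) = x₀ := by simp only [σ, hτ, hr₀]
  have hgj : ∀ j, ∃ U : Set (M × M), IsOpen U ∧ (x₀, x₀) ∈ U ∧ ∃ H ∈ prodD D D,
      ∀ r : {p : M × M | S.r p.1 p.2}, (r : M × M) ∈ U → (g r j : ℂ) = H r := fun j =>
    hg (fun t => (t j : ℂ)) (contDiff_ofReal.comp (contDiff_apply ℝ ℝ j)) r₀
  choose U hU hxU H hH hgH using hgj
  let p : M → Fin n → ℝ := fun y j => (H j (x₀, y)).re
  have hp : ∀ j, (fun y => (p y j : ℂ)) ∈ D := fun j => hS.mem_of_germ fun y =>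
    hS.germ_comp_one (smoothGerm_of_mem (slice_mem hS (hH j) x₀) y) (F := fun c => (c.re : ℂ))
      (contDiff_ofReal.comp Complex.reCLM.contDiff)
  have hid : ∀ᶠ t in 𝓝 t₀, p (σ (x₀, t)) = t := by
    have hmk : ContinuousAt (fun t : Fin n → ℝ => (x₀, t)) t₀ := by fun_prop
    have hτU : ∀ᶠ v in 𝓝 (x₀, t₀), ∀ j, ((τ v : M × M)) ∈ U j :=
      Filter.eventually_all.2 fun j =>
        (continuous_subtype_val.continuousAt.comp hinv.self_of_nhds.2.1).eventually
          ((hU j).mem_nhds (by simpa [hτ, hr₀] using hxU j))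
    filter_upwards [hmk.eventually hinv, hmk.eventually hτU] with t ht htU
    have h1 : (τ (x₀, t)).1.1 = x₀ := congrArg Prod.fst ht.1
    have h2 : g (τ (x₀, t)) = t := congrArg Prod.snd ht.1
    funext j
    have h3 : H j (x₀, σ (x₀, t)) = (t j : ℂ) := by
      rw [← congrFun h2 j, hgH j _ (htU j)]
      congr 1
      exact Prod.ext h1.symm rfl
    simp only [p, h3, Complex.ofReal_re]
  have hp₀ : p x₀ = t₀ := by
    have := hid.self_of_nhds
    rwa [hσ₀] at this
  obtain ⟨m, φ, hφ, W, hW, hxW, hgen⟩ := hfd.exists_generators x₀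
  have hφc : Continuous φ := continuous_pi fun i => hD.continuous _ (hφ i)
  have hF : ∀ j, ∃ F : (Fin m → ℂ) × (Fin n → ℝ) → ℂ, ContDiff ℝ (⊤ : ℕ∞) F ∧
      ∀ᶠ v in 𝓝 (x₀, t₀), (p (σ v) j : ℂ) = F (φ v.1, v.2) := fun j =>
    exists_eventuallyEq_of_generators hW hgen hxW ((hσ _ hinv.self_of_nhds.2).2 _ (hp j))
  choose F hFs hF using hF
  let K : (Fin m → ℂ) × (Fin n → ℝ) → Fin n → ℝ := fun w j => (F j w).re
  have hK : ContDiff ℝ (⊤ : ℕ∞) K := contDiff_pi.2 fun j => Complex.reCLM.contDiff.comp (hFs j)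
  have hpK : ∀ᶠ v in 𝓝 (x₀, t₀), p (σ v) = K (φ v.1, v.2) := by
    filter_upwards [Filter.eventually_all.2 hF] with v hv
    funext j
    simp only [K, ← hv j, Complex.ofReal_re]
  have hKid : ∀ᶠ t in 𝓝 t₀, K (φ x₀, t) = t := by
    have hmk : ContinuousAt (fun t : Fin n → ℝ => (x₀, t)) t₀ := by fun_prop
    filter_upwards [hid, hmk.eventually hpK] with t h1 h2
    rw [← h2, h1]
  obtain ⟨T, hT₀, hT, hTK⟩ := exists_parametric_inverse hK hKid
  let a : M × (Fin n → ℝ) → (Fin m → ℂ) × (Fin n → ℝ) := fun v => (φ v.1, v.2)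
  have ha : ContinuousAt a (x₀, t₀) := by
    simp only [a]; fun_prop
  let b : M × (Fin n → ℝ) → M × (Fin n → ℝ) := fun v => (v.1, T (a v))
  have hb : Filter.Tendsto b (𝓝 (x₀, t₀)) (𝓝 (x₀, t₀)) := by
    have h1 : ContinuousAt b (x₀, t₀) :=
      continuousAt_fst.prodMk (ContinuousAt.comp hT.self_of_nhds.1.continuousAt ha)
    have h2 : b (x₀, t₀) = (x₀, t₀) := by simp only [b, a, hT₀]
    rwa [ContinuousAt, h2] at h1
  have hSp : IsSmoothSheaf (prodD D (euclD n)) := isSmoothSheaf_prodD _ _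
  refine ⟨n, p, fun v => σ (b v), hp, ?_, ?_, ?_⟩
  · simp only [b, a, hp₀, hT₀, hσ₀]
  · rw [hp₀]
    filter_upwards [hb.eventually (hinv.and hpK), ha.eventually (eventually_eventually_nhds.2 hT)]
      with v hv hTv
    have hav : SmoothMapAt (prodD D (euclD n)) (smoothFunctions _) a v :=
      SmoothMapAt.prodMk_normed hSp
        (SmoothMapAt.comp (smoothMapAt_pi_complex hS hφc.continuousAt
          fun i => smoothGerm_of_mem (hφ i) _) (smoothMapAt_fst v))
        (smoothMapAt_snd (D' := euclD n) v)
    have hbv : SmoothMapAt (prodD D (euclD n)) (prodD D (euclD n)) b v :=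
      SmoothMapAt.prodMk hSp (smoothMapAt_fst v)
        ((smoothMapAt_of_contDiffAt (hTv.mono fun _ h => h.1)).comp hav)
    refine ⟨(hσ _ hv.1.2).comp hbv, ?_, ?_⟩
    · have h1 : (τ (b v)).1.1 = v.1 := congrArg Prod.fst hv.1.1
      have h2 := (τ (b v)).2
      rw [Set.mem_ofPred_eq, h1] at h2
      exact h2
    · rw [hv.2]
      exact hTv.self_of_nhds.2
  · have hR : ∀ᶠ r : {p : M × M | S.r p.1 p.2} in 𝓝 r₀, σ (b (r.1.1, p r.1.2)) = r.1.2 := by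
      filter_upwards [hleft, hfc.eventually hpK, hfc.eventually (ha.eventually hTK)] with r h1 h2 h3
      have h4 : σ (r.1.1, g r) = r.1.2 := by simp only [σ, h1]
      have h5 : p r.1.2 = K (φ r.1.1, g r) := by rw [← h4]; exact h2
      have h6 : b (r.1.1, p r.1.2) = (r.1.1, g r) := by
        rw [h5]
        exact Prod.ext rfl h3
      rw [h6, h4]
    rw [nhds_subtype_eq_comap, Filter.eventually_comap] at hR
    filter_upwards [hR] with v hv hrel
    exact hv ⟨v, hrel⟩ rfl

end AdaptedChart

section Quotient

variable {M : Type*} [TopologicalSpace M] {D : Set (M → ℂ)} {S : Setoid M}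

/-- The functions on a quotient whose pullback is a structure function. -/
def quotientD (D : Set (M → ℂ)) (S : Setoid M) : Set (Quotient S → ℂ) :=
  {f | (f ∘ Quotient.mk S) ∈ D}

/-- Through each pair of equivalent points passes a smooth local section of the equivalence
relation. -/
def HasLocalSections (D : Set (M → ℂ)) (S : Setoid M) : Prop :=
  ∀ ⦃x y : M⦄, S.r x y →
    ∃ s : M → M, s x = y ∧ SmoothMapAt D D s x ∧ ∀ᶠ z in 𝓝 x, S.r z (s z)

theorem HasLocalSections.isOpenQuotientMap (h : HasLocalSections D S) :
    IsOpenQuotientMap (Quotient.mk S) := by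
  refine ⟨Quotient.mk_surjective, continuous_quotient_mk', fun U hU => ?_⟩
  refine isQuotientMap_quotient_mk'.isOpen_preimage.1 (isOpen_iff_mem_nhds.2 ?_)
  rintro z ⟨w, hw, hwz⟩
  obtain ⟨s, hs, hsm, hrel⟩ := h (S.iseqv.symm (Quotient.exact hwz))
  filter_upwards [hrel, hsm.1.eventually (hU.mem_nhds (hs.symm ▸ hw))] with v h1 h2
  exact ⟨s v, h2, (Quotient.sound h1).symm⟩

theorem HasLocalSections.smoothGerm_of_rel (h : HasLocalSections D S) {α : Quotient S → ℂ}
    {x y : M} (hxy : S.r x y) (hα : SmoothGerm D (α ∘ Quotient.mk S) y) :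
    SmoothGerm D (α ∘ Quotient.mk S) x := by
  obtain ⟨s, hs, hsm, hrel⟩ := h hxy
  refine (hsm.germ (hs.symm ▸ hα)).congr ?_
  filter_upwards [hrel] with z hz
  exact congrArg α (Quotient.sound hz)

theorem isSmoothSheaf_quotientD (hD : IsSmoothSheaf D) : IsSmoothSheaf (quotientD D S) where
  comp n g hg F hF := hD.comp n (fun i => g i ∘ Quotient.mk S) hg F hF
  locality f hf := hD.locality _ fun x => by
    obtain ⟨U, hU, g, hg, he⟩ := hf (Quotient.mk S x)
    exact ⟨Quotient.mk S ⁻¹' U, continuous_quotient_mk'.continuousAt hU, g ∘ Quotient.mk S, hg,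
      fun y hy => he _ hy⟩

theorem smoothMapAt_mk (x : M) : SmoothMapAt D (quotientD D S) (Quotient.mk S) x :=
  ⟨continuous_quotient_mk'.continuousAt, fun _ hg =>
    smoothGerm_of_mem (D := D) hg x⟩

/-- `ρ` retracts the open set `V` along equivalence classes onto a transversal, and `Θ` recovers
the points `z` of `V` from `ρ z` and their coordinates `p z`. -/
structure IsSlice (D : Set (M → ℂ)) (S : Setoid M) {n : ℕ} (V : Set M) (p : M → Fin n → ℝ)
    (ρ : M → M) (Θ : M × (Fin n → ℝ) → M) : Prop where
  isOpen : IsOpen V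
  coord_mem : ∀ j, (fun y => (p y j : ℂ)) ∈ D
  smooth : ∀ z ∈ V, SmoothMapAt D D ρ z
  rel : ∀ z ∈ V, S.r z (ρ z)
  eq_of_rel : ∀ z ∈ V, ∀ w ∈ V, S.r z w → ρ z = ρ w
  smooth_chart : ∀ z ∈ V, SmoothMapAt (prodD D (euclD n)) D Θ (ρ z, p z)
  chart_eq : ∀ z ∈ V, Θ (ρ z, p z) = z
  rel_chart : ∀ z ∈ V, ∀ᶠ v in 𝓝 (ρ z, p z), S.r v.1 (Θ v) ∧ p (Θ v) = v.2

theorem exists_isSlice (hD : IsDiffStructure M D) (hfd : LocallyFinDimD D)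
    (hsub : DSubmersion (restrictD (prodD D D) {p : M × M | S.r p.1 p.2}) D
      (fun p : {p : M × M | S.r p.1 p.2} => (p : M × M).1)) {U : Set M} (hU : IsOpen U)
    {x₀ : M} (hx₀ : x₀ ∈ U) :
    ∃ (n : ℕ) (p : M → Fin n → ℝ) (ρ : M → M) (Θ : M × (Fin n → ℝ) → M) (V : Set M),
      IsSlice D S V p ρ Θ ∧ x₀ ∈ V ∧ ∀ z ∈ V, ρ z ∈ U := by
  obtain ⟨n, p, Θ, hp, hΘ₀, hΘ, hfix⟩ := exists_adapted_chart hD hfd hsub x₀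
  have hpc : Continuous p :=
    continuous_pi fun j => Complex.continuous_re.comp (hD.continuous _ (hp j))
  obtain ⟨V₁, V₂, hV₁, hx₁, hV₂, hx₂, hV₁₂⟩ := mem_nhds_prod_iff'.1 hfix
  obtain ⟨V₃, B₀, hV₃, hx₃, hB₀, hs₀, hVB⟩ :=
    mem_nhds_prod_iff'.1 (eventually_eventually_nhds.2 hΘ)
  let V := U ∩ (V₁ ∩ V₂ ∩ V₃)
  have hV : IsOpen V := hU.inter ((hV₁.inter hV₂).inter hV₃)
  have hxV : x₀ ∈ V := ⟨hx₀, ⟨hx₁, hx₂⟩, hx₃⟩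
  have hfixV : ∀ z ∈ V, ∀ w ∈ V, S.r z w → Θ (z, p w) = w := fun z hz w hw hzw =>
    hV₁₂ (Set.mk_mem_prod hz.2.1.1 hw.2.1.2) hzw
  have hgood : ∀ z ∈ V, ∀ s ∈ B₀, ∀ᶠ v in 𝓝 (z, s), SmoothMapAt (prodD D (euclD n)) D Θ v ∧
      S.r v.1 (Θ v) ∧ p (Θ v) = v.2 := fun z hz s hs => hVB (Set.mk_mem_prod hz.2.2 hs)
  have hΘV : ∀ᶠ v in 𝓝 (x₀, p x₀), Θ v ∈ V :=
    hΘ.self_of_nhds.1.1.eventually (hV.mem_nhds (hΘ₀.symm ▸ hxV))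
  obtain ⟨V₄, B₁, hV₄, hx₄, hB₁, hs₁, hVB'⟩ := mem_nhds_prod_iff'.1 hΘV
  let B := B₀ ∩ B₁
  let V' := V ∩ V₄ ∩ p ⁻¹' B
  have hmem : ∀ z ∈ V', ∀ s ∈ B, Θ (z, s) ∈ V := fun z hz s hs =>
    hVB' (Set.mk_mem_prod hz.1.2 hs.2)
  have hrel : ∀ z ∈ V, ∀ s ∈ B, S.r z (Θ (z, s)) := fun z hz s hs =>
    (hgood z hz s hs.1).self_of_nhds.2.1
  have hinvar : ∀ z ∈ V, ∀ w ∈ V', ∀ s ∈ B, S.r z w → Θ (z, s) = Θ (w, s) :=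
    fun z hz w hw s hs hzw => by
      have h := hfixV z hz (Θ (w, s)) (hmem w hw s hs)
        (S.iseqv.trans hzw (hrel w hw.1.1 s hs))
      rwa [(hgood w hw.1.1 s hs.1).self_of_nhds.2.2] at h
  have hsB : p x₀ ∈ B := ⟨hs₀, hs₁⟩
  refine ⟨n, p, fun z => Θ (z, p x₀), Θ, V', ⟨?_, hp, ?_, ?_, ?_, ?_, ?_, ?_⟩,
    ⟨⟨hxV, hx₄⟩, hsB⟩, fun z hz => (hmem z hz _ hsB).1⟩
  · exact (hV.inter hV₄).inter ((hB₀.inter hB₁).preimage hpc)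
  · intro z hz
    exact SmoothMapAt.comp (f := fun z => (z, p x₀)) (hgood z hz.1.1 _ hs₀).self_of_nhds.1
      (SmoothMapAt.prodMk hD.isSmoothSheaf (smoothMapAt_id z)
        (smoothMapAt_const hD.isSmoothSheaf z _))
  · exact fun z hz => hrel z hz.1.1 _ hsB
  · exact fun z hz w hw hzw => hinvar z hz.1.1 w hw _ hsB hzw
  · exact fun z hz => (hgood _ (hmem z hz _ hsB) _ hz.2.1).self_of_nhds.1
  · intro z hz
    rw [hinvar _ (hmem z hz _ hsB) z hz _ hz.2 (S.iseqv.symm (hrel z hz.1.1 _ hsB))]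
    exact hfixV z hz.1.1 z hz.1.1 (S.iseqv.refl z)
  · exact fun z hz => (hgood _ (hmem z hz _ hsB) _ hz.2.1).mono fun v hv => hv.2

section Slice

variable {n : ℕ} {V : Set M} {p : M → Fin n → ℝ} {ρ : M → M} {Θ : M × (Fin n → ℝ) → M}
  {r : Quotient S → M}

theorem IsSlice.exists_lift (hs : IsSlice D S V p ρ Θ) :
    ∃ r : Quotient S → M, ∀ z ∈ V, r (Quotient.mk S z) = ρ z := by
  classical
  refine ⟨fun q => if h : ∃ z ∈ V, Quotient.mk S z = q then ρ h.choose else q.out, fun z hz => ?_⟩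
  have h : ∃ w ∈ V, Quotient.mk S w = Quotient.mk S z := ⟨z, hz, rfl⟩
  simp only [dif_pos h]
  exact hs.eq_of_rel _ h.choose_spec.1 _ hz (Quotient.exact h.choose_spec.2)

theorem IsSlice.mk_lift (hs : IsSlice D S V p ρ Θ)
    (hr : ∀ z ∈ V, r (Quotient.mk S z) = ρ z) {q : Quotient S} (hq : q ∈ Quotient.mk S '' V) :
    Quotient.mk S (r q) = q := by
  obtain ⟨z, hz, rfl⟩ := hq
  rw [hr z hz]
  exact (Quotient.sound (hs.rel z hz)).symm

theorem IsSlice.continuousAt_lift (hs : IsSlice D S V p ρ Θ)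
    (hr : ∀ z ∈ V, r (Quotient.mk S z) = ρ z) (hQ : IsOpenQuotientMap (Quotient.mk S))
    {q : Quotient S} (hq : q ∈ Quotient.mk S '' V) : ContinuousAt r q := by
  obtain ⟨z, hz, rfl⟩ := hq
  refine hQ.continuousAt_comp_iff.1 ((hs.smooth z hz).1.congr ?_)
  filter_upwards [hs.isOpen.mem_nhds hz] with w hw
  exact (hr w hw).symm

theorem IsSlice.smoothGerm_comp_lift (hs : IsSlice D S V p ρ Θ)
    (hr : ∀ z ∈ V, r (Quotient.mk S z) = ρ z) (h : HasLocalSections D S) {g : M → ℂ} (hg : g ∈ D)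
    {z : M} (hz : Quotient.mk S z ∈ Quotient.mk S '' V) :
    SmoothGerm D ((g ∘ r) ∘ Quotient.mk S) z := by
  obtain ⟨w, hw, hwz⟩ := hz
  refine h.smoothGerm_of_rel (S.iseqv.symm (Quotient.exact hwz))
    (((hs.smooth w hw).2 g hg).congr ?_)
  filter_upwards [hs.isOpen.mem_nhds hw] with v hv
  exact congrArg g (hr v hv)

end Slice

theorem exists_quotient_bump [T2Space (Quotient S)] [LocallyCompactSpace (Quotient S)]
    (hD : IsDiffStructure M D) (hfd : LocallyFinDimD D)
    (hsub : DSubmersion (restrictD (prodD D D) {p : M × M | S.r p.1 p.2}) D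
      (fun p : {p : M × M | S.r p.1 p.2} => (p : M × M).1))
    (q : Quotient S) {U : Set (Quotient S)} (hU : U ∈ 𝓝 q) :
    ∃ χ ∈ quotientD D S, ∃ K, IsCompact K ∧ K ⊆ U ∧ (∀ y ∉ K, χ y = 0) ∧
      χ =ᶠ[𝓝 q] fun _ => 1 := by
  have hS := hD.isSmoothSheaf
  have hsec : HasLocalSections D S := fun x y h => exists_local_section hD hsub h
  have hQ := hsec.isOpenQuotientMap
  obtain ⟨x₀, rfl⟩ := hQ.surjective q
  obtain ⟨m, φ, hφ, W, hW, hxW, hgen⟩ := hfd.exists_generators x₀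
  have hφinj : ∀ a ∈ W, ∀ b ∈ W, φ a = φ b → a = b := fun a ha b hb hab => by
    by_contra hne
    obtain ⟨f, hf, hfab⟩ := hD.separates a b hne
    obtain ⟨F, -, hF⟩ := hgen f hf
    exact hfab (by rw [hF a ha, hF b hb, hab])
  obtain ⟨n, p, ρ, Θ, V, hs, hxV, hρW⟩ := exists_isSlice hD hfd hsub hW hxW
  obtain ⟨r, hr⟩ := hs.exists_lift
  let N : M → ℝ := fun y => ∑ i, Complex.normSq (φ y i - φ (r (Quotient.mk S x₀)) i)
  have hNc : Continuous N := by
    have := fun i => hD.continuous _ (hφ i)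
    have := Complex.continuous_normSq
    fun_prop
  have hrW : ∀ y ∈ Quotient.mk S '' V, r y ∈ W := by
    rintro _ ⟨z, hz, rfl⟩
    rw [hr z hz]
    exact hρW z hz
  have hx₀ : Quotient.mk S x₀ ∈ Quotient.mk S '' V := ⟨x₀, hxV, rfl⟩
  obtain ⟨K, χ, β, hK, hKU, hβ, hχK, hχ0, hχ1⟩ := exists_bump (q := fun y => N (r y))
    (hQ.isOpenMap V hs.isOpen) hx₀
    (fun y hy => (hNc.continuousAt.comp (hs.continuousAt_lift hr hQ hy)).continuousWithinAt)
    (by simp [N])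
    (fun y hy hne => by
      refine lt_of_le_of_ne (Finset.sum_nonneg fun i _ => Complex.normSq_nonneg _) fun h0 => hne ?_
      have h1 := (Finset.sum_eq_zero_iff_of_nonneg fun i _ => Complex.normSq_nonneg _).1 h0.symm
      have h2 := hφinj _ (hrW y hy) _ (hrW _ hx₀) (funext fun i => by
        simpa [sub_eq_zero] using h1 i (Finset.mem_univ i))
      rw [← hs.mk_lift hr hy, h2, hs.mk_lift hr hx₀]) hU
  have hβN : (fun y => (β (N y) : ℂ)) ∈ D := by
    refine hS.comp_fintype hφ
      (F := fun c => (β (∑ i, Complex.normSq (c i - φ (r (Quotient.mk S x₀)) i)) : ℂ)) ?_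
    refine contDiff_ofReal.comp (hβ.comp (ContDiff.sum fun i _ => ?_))
    have h1 : ContDiff ℝ (⊤ : ℕ∞) fun c : ℂ => Complex.normSq c := by
      simp only [Complex.normSq_apply]
      exact (Complex.reCLM.contDiff.mul Complex.reCLM.contDiff).add
        (Complex.imCLM.contDiff.mul Complex.imCLM.contDiff)
    exact h1.comp ((contDiff_apply ℝ ℂ i).sub contDiff_const)
  refine ⟨χ, hS.mem_of_germ fun z => ?_, K, hK, fun y hy => (hKU hy).1,
    fun y hy => (hχ0 y hy).self_of_nhds, hχ1⟩
  have hc := hQ.continuous.continuousAt (x := z)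
  by_cases hz : Quotient.mk S z ∈ K
  · exact (hs.smoothGerm_comp_lift hr hsec hβN (hKU hz).2).congr (hc.eventually (hχK _ hz))
  · exact (smoothGerm_of_mem (hS.const_mem 0) z).congr (hc.eventually (hχ0 _ hz))

/-- In the presence of bump functions, smoothness of germs on the quotient can be checked after
pulling back. -/
theorem smoothGerm_quotientD [T2Space (Quotient S)] (hS : IsSmoothSheaf D)
    {q : Quotient S} {O : Set (Quotient S)} (hO : O ∈ 𝓝 q)
    (hbump : ∀ U ∈ 𝓝 q, ∃ χ ∈ quotientD D S, ∃ K, IsCompact K ∧ K ⊆ U ∧ (∀ y ∉ K, χ y = 0) ∧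
      χ =ᶠ[𝓝 q] fun _ => 1)
    {α : Quotient S → ℂ} (hα : ∀ z, Quotient.mk S z ∈ O → SmoothGerm D (α ∘ Quotient.mk S) z) :
    SmoothGerm (quotientD D S) α q := by
  obtain ⟨χ, hχ, K, hK, hKO, hχ0, hχ1⟩ := hbump O hO
  refine ⟨fun y => χ y * α y, hS.mem_of_germ fun z => ?_, ?_⟩
  · by_cases hz : Quotient.mk S z ∈ K
    · exact hS.germ_mul (smoothGerm_of_mem (D := D) hχ z) (hα z (hKO hz))
    · refine (smoothGerm_of_mem (hS.const_mem 0) z).congr ?_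
      filter_upwards [(continuous_quotient_mk' (s := S)).continuousAt.eventually
        (hK.isClosed.isOpen_compl.mem_nhds hz)] with y hy
      have h0 : χ (Quotient.mk S y) = 0 := hχ0 _ hy
      simp [h0]
  · filter_upwards [hχ1] with y hy
    simp [hy]

theorem isDiffStructure_quotientD [T2Space (Quotient S)] (hD : IsDiffStructure M D)
    (hbump : ∀ q : Quotient S, ∀ U ∈ 𝓝 q, ∃ χ ∈ quotientD D S, ∃ K, IsCompact K ∧ K ⊆ U ∧
      (∀ y ∉ K, χ y = 0) ∧ χ =ᶠ[𝓝 q] fun _ => 1) :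
    IsDiffStructure (Quotient S) (quotientD D S) where
  nonempty := ⟨fun _ => 0, hD.isSmoothSheaf.const_mem 0⟩
  continuous f hf := isQuotientMap_quotient_mk'.continuous_iff.2 (hD.continuous _ hf)
  separates x y hxy := by
    obtain ⟨χ, hχ, K, -, hKU, hχ0, hχ1⟩ := hbump x {y}ᶜ (isOpen_compl_singleton.mem_nhds hxy)
    refine ⟨χ, hχ, ?_⟩
    rw [hχ1.self_of_nhds, hχ0 y fun hy => hKU hy rfl]
    exact one_ne_zero
  comp := (isSmoothSheaf_quotientD hD.isSmoothSheaf).comp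
  locality := (isSmoothSheaf_quotientD hD.isSmoothSheaf).locality

theorem locallyFinDimD_quotientD [T2Space (Quotient S)] [LocallyCompactSpace (Quotient S)]
    (hD : IsDiffStructure M D) (hfd : LocallyFinDimD D)
    (hsub : DSubmersion (restrictD (prodD D D) {p : M × M | S.r p.1 p.2}) D
      (fun p : {p : M × M | S.r p.1 p.2} => (p : M × M).1)) :
    LocallyFinDimD (quotientD D S) := by
  have hbump : ∀ q : Quotient S, ∀ U ∈ 𝓝 q, ∃ χ ∈ quotientD D S, ∃ K, IsCompact K ∧ K ⊆ U ∧
      (∀ y ∉ K, χ y = 0) ∧ χ =ᶠ[𝓝 q] fun _ => 1 := fun q U hU =>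
    exists_quotient_bump hD hfd hsub q hU
  have hsec : HasLocalSections D S := fun x y h => exists_local_section hD hsub h
  have hQ := hsec.isOpenQuotientMap
  refine locallyFinDimD_of_generators (isDiffStructure_quotientD hD hbump) (fun q => ?_) hbump
  obtain ⟨x₀, rfl⟩ := hQ.surjective q
  obtain ⟨m, φ, hφ, W, hW, hxW, hgen⟩ := hfd.exists_generators x₀
  obtain ⟨n, p, ρ, Θ, V, hs, hxV, hρW⟩ := exists_isSlice hD hfd hsub hW hxW
  obtain ⟨r, hr⟩ := hs.exists_lift
  have hO := hQ.isOpenMap V hs.isOpen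
  have hx₀ : Quotient.mk S x₀ ∈ Quotient.mk S '' V := ⟨x₀, hxV, rfl⟩
  have hψ : ∀ i, SmoothGerm (quotientD D S) ((fun y => φ y i) ∘ r) (Quotient.mk S x₀) := fun i =>
    smoothGerm_quotientD hD.isSmoothSheaf (hO.mem_nhds hx₀) (hbump _)
      fun z hz => hs.smoothGerm_comp_lift hr hsec (hφ i) hz
  choose ψ hψD hψ using hψ
  obtain ⟨A, hA, hAo, hxA⟩ := eventually_nhds_iff.1 (Filter.eventually_all.2 hψ)
  refine ⟨m, fun y i => ψ i y, hψD, A ∩ Quotient.mk S '' V, hAo.inter hO, ⟨hxA, hx₀⟩,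
    fun f hf => ?_⟩
  obtain ⟨F, hF, hfF⟩ := hgen _ hf
  refine ⟨F, hF, fun y hy => ?_⟩
  have hry : r y ∈ W := by
    obtain ⟨-, z, hz, rfl⟩ := hy
    rw [hr z hz]
    exact hρW z hz
  have h1 := hfF _ hry
  rw [Function.comp_apply, hs.mk_lift hr hy.2] at h1
  rw [h1]
  congr 1
  funext i
  exact hA y hy.1 i

theorem dSubmersion_mk [T2Space (Quotient S)] [LocallyCompactSpace (Quotient S)]
    (hD : IsDiffStructure M D) (hfd : LocallyFinDimD D)
    (hsub : DSubmersion (restrictD (prodD D D) {p : M × M | S.r p.1 p.2}) D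
      (fun p : {p : M × M | S.r p.1 p.2} => (p : M × M).1)) :
    DSubmersion D (quotientD D S) (Quotient.mk S) := by
  intro x₀
  have hS := hD.isSmoothSheaf
  have hsec : HasLocalSections D S := fun x y h => exists_local_section hD hsub h
  have hQ := hsec.isOpenQuotientMap
  obtain ⟨n, p, ρ, Θ, V, hs, hxV, -⟩ := exists_isSlice hD hfd hsub isOpen_univ (Set.mem_univ x₀)
  obtain ⟨r, hr⟩ := hs.exists_lift
  have hO := hQ.isOpenMap V hs.isOpen
  have hp : ∀ z, SmoothMapAt D (euclD n) p z := fun z => smoothMapAt_pi_real hS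
    (continuous_pi fun j => Complex.continuous_re.comp
      (hD.continuous _ (hs.coord_mem j))).continuousAt
    fun j => smoothGerm_of_mem (hs.coord_mem j) z
  refine ⟨n, p, fun g hg => hS.mem_of_germ fun z => (hp z).2 g hg, V, hs.isOpen, hxV,
    isOpenSmoothEmbedding_of_local_inverse hs.isOpen ?_
      (fun z _ => SmoothMapAt.prodMk hS (smoothMapAt_mk z) (hp z)) fun z hz => ?_⟩
  · intro z hz w hw hzw
    obtain ⟨h1, h2⟩ := Prod.ext_iff.1 hzw
    rw [← hs.chart_eq z hz, ← hs.chart_eq w hw, hs.eq_of_rel z hz w hw (Quotient.exact h1)]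
    exact congrArg _ (congrArg _ h2)
  · have hz' : Quotient.mk S z ∈ Quotient.mk S '' V := ⟨z, hz, rfl⟩
    have hrs : SmoothMapAt (quotientD D S) D r (Quotient.mk S z) :=
      ⟨hs.continuousAt_lift hr hQ hz', fun g hg =>
        smoothGerm_quotientD hS (hO.mem_nhds hz')
          (fun U hU => exists_quotient_bump hD hfd hsub _ hU)
          fun w hw => hs.smoothGerm_comp_lift hr hsec hg hw⟩
    have hb : SmoothMapAt (prodD (quotientD D S) (euclD n)) (prodD D (euclD n))
        (fun y => (r y.1, y.2)) (Quotient.mk S z, p z) :=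
      SmoothMapAt.prodMk (isSmoothSheaf_prodD _ _)
        (SmoothMapAt.comp (f := fun y : Quotient S × (Fin n → ℝ) => y.1) hrs
          (smoothMapAt_fst _)) (smoothMapAt_snd _)
    refine ⟨fun y => Θ (r y.1, y.2), SmoothMapAt.comp (g := Θ) ?_ hb, ?_, ?_⟩
    · simp only [hr z hz]
      exact hs.smooth_chart z hz
    · filter_upwards [hs.isOpen.mem_nhds hz] with w hw
      rw [hr w hw, hs.chart_eq w hw]
    · have hchart := hs.rel_chart z hz
      rw [← hr z hz] at hchart
      filter_upwards [hb.1.eventually hchart,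
        continuousAt_fst.eventually (hO.mem_nhds hz')] with y hy hyO
      refine Prod.ext ?_ hy.2
      exact (Quotient.sound hy.1).symm.trans (hs.mk_lift hr hyO)

end Quotient

/-- Quotient theorem for differential spaces: if `R` is a closed equivalence relation on a
locally finite-dimensional differential space `M` whose first projection `R → M` is a
submersion, then the quotient is again a locally finite-dimensional differential space (with
the functions whose pullback is smooth) and the quotient map is a submersion. -/
theorem stmt_1
    {M : Type*} [TopologicalSpace M] [T2Space M] [LocallyCompactSpace M]
    [SecondCountableTopology M]
    (D : Set (M → ℂ)) (hD : IsDiffStructure M D) (hfd : LocallyFinDimD D)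
    (S : Setoid M)
    (hclosed : IsClosed {p : M × M | S.r p.1 p.2})
    (hsub : DSubmersion (restrictD (prodD D D) {p : M × M | S.r p.1 p.2}) D
      (fun p : {p : M × M | S.r p.1 p.2} => (p : M × M).1)) :
    T2Space (Quotient S) ∧ LocallyCompactSpace (Quotient S) ∧
    SecondCountableTopology (Quotient S) ∧
    IsDiffStructure (Quotient S) {f : Quotient S → ℂ | (f ∘ Quotient.mk S) ∈ D} ∧
    LocallyFinDimD {f : Quotient S → ℂ | (f ∘ Quotient.mk S) ∈ D} ∧
    DSubmersion D {f : Quotient S → ℂ | (f ∘ Quotient.mk S) ∈ D} (Quotient.mk S) := by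
  have hsec : HasLocalSections D S := fun x y h => exists_local_section hD hsub h
  have hQ := hsec.isOpenQuotientMap
  have hT2 : T2Space (Quotient S) := by
    refine (t2Space_iff_of_isOpenQuotientMap hQ).2 ?_
    convert hclosed using 1
    ext v
    exact Quotient.eq
  have hLC : LocallyCompactSpace (Quotient S) := hQ.locallyCompactSpace
  have hbump := fun (q : Quotient S) U (hU : U ∈ 𝓝 q) => exists_quotient_bump hD hfd hsub q hU
  exact ⟨hT2, hLC, TopologicalSpace.Quotient.secondCountableTopology hQ.isOpenMap,
    isDiffStructure_quotientD hD hbump, locallyFinDimD_quotientD hD hfd hsub,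
    dSubmersion_mk hD hfd hsub⟩
end
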